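/- Let F ∈ A²₁, where A²₁ is the Bergman-type space of analytic functions F on 𝔻 with ‖F‖² = ∫_𝔻 |F(z)|²(1 − |z|²) dA(z) < ∞, and let [F] denote the closure in A²₁ of the set of polynomial multiples {PF : P a polynomial}. Then there exists a function G ∈ QA such that G' ∈ A²₁ and [G'] = [F]. -/

import Mathlib

open MeasureTheory Filter Set Topology

noncomputable section

/-- The open unit disc in `ℂ`. -/
def unitDisc : Set ℂ := {z : ℂ | ‖z‖ < 1}

/-- The point `e^{iθ}` on the unit circle. -/
def circlePt (θ : ℝ) : ℂ := Complex.exp ((θ : ℂ) * Complex.I)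

/-- The Carleson square based on the arc centered at `e^{iθ₀}` of normalized length `t`. -/
def carlesonSquare (θ₀ t : ℝ) : Set ℂ :=
  {z : ℂ | z ∈ unitDisc ∧ 1 - t ≤ ‖z‖ ∧
    ∃ θ : ℝ, |θ - θ₀| ≤ Real.pi * t ∧ z = (‖z‖ : ℂ) * circlePt θ}

/-- `μ` is a Carleson measure. -/
def IsCarleson (μ : Measure ℂ) : Prop :=
  ∃ C : ℝ, 0 < C ∧ ∀ θ₀ t : ℝ, 0 < t → t ≤ 1 →
    μ (carlesonSquare θ₀ t) ≤ ENNReal.ofReal (C * t)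

/-- `μ` is a vanishing Carleson measure. -/
def IsVanishingCarleson (μ : Measure ℂ) : Prop :=
  IsCarleson μ ∧ ∀ ε : ℝ, 0 < ε → ∃ δ : ℝ, 0 < δ ∧ ∀ θ₀ t : ℝ, 0 < t → t < δ →
    μ (carlesonSquare θ₀ t) ≤ ENNReal.ofReal (ε * t)

/-- The measure `|E| μ`, i.e. `d(|E|μ)(z) = |E(z)| dμ(z)`. -/
def absDensity (E : ℂ → ℂ) (μ : Measure ℂ) : Measure ℂ :=
  μ.withDensity (fun z => ENNReal.ofReal ‖E z‖)

/-- Average of a boundary function (in the angle variable) over the arc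
centered at `e^{iθ₀}` of normalized length `t`; `dm = dθ/(2π)`. -/
def arcAvg (f : ℝ → ℂ) (θ₀ t : ℝ) : ℂ :=
  ((2 * Real.pi * t)⁻¹ : ℝ) •
    ∫ θ in Set.Ioo (θ₀ - Real.pi * t) (θ₀ + Real.pi * t), f θ

/-- Mean oscillation of a boundary function over the arc centered at `e^{iθ₀}`
of normalized length `t`. -/
def meanOsc (f : ℝ → ℂ) (θ₀ t : ℝ) : ℝ :=
  (2 * Real.pi * t)⁻¹ *
    ∫ θ in Set.Ioo (θ₀ - Real.pi * t) (θ₀ + Real.pi * t), ‖f θ - arcAvg f θ₀ t‖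

/-- A (2π-periodic, integrable) boundary function has bounded mean oscillation. -/
def IsBMO (f : ℝ → ℂ) : Prop :=
  (∀ θ : ℝ, f (θ + 2 * Real.pi) = f θ) ∧
  IntegrableOn f (Set.Ioc 0 (2 * Real.pi)) ∧
  ∃ C : ℝ, ∀ θ₀ t : ℝ, 0 < t → t ≤ 1 → meanOsc f θ₀ t ≤ C

/-- A boundary function has vanishing mean oscillation. -/
def IsVMO (f : ℝ → ℂ) : Prop :=
  IsBMO f ∧ ∀ ε : ℝ, 0 < ε → ∃ δ : ℝ, 0 < δ ∧
    ∀ θ₀ t : ℝ, 0 < t → t < δ → meanOsc f θ₀ t ≤ ε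

/-- The BMO seminorm of a boundary function. -/
def bmoSeminorm (f : ℝ → ℂ) : ℝ :=
  sSup {c : ℝ | ∃ θ₀ t : ℝ, 0 < t ∧ t ≤ 1 ∧ c = meanOsc f θ₀ t}

/-- `Fb` is the (a.e.) radial boundary function of `F`. -/
def HasRadialLimits (F : ℂ → ℂ) (Fb : ℝ → ℂ) : Prop :=
  ∀ᵐ θ ∂(volume.restrict (Set.Ioc 0 (2 * Real.pi))),
    Tendsto (fun r : ℝ => F ((r : ℂ) * circlePt θ))
      (nhdsWithin 1 (Set.Iio 1)) (nhds (Fb θ))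

/-- `F` is a bounded analytic function on the unit disc. -/
def MemHinf (F : ℂ → ℂ) : Prop :=
  DifferentiableOn ℂ F unitDisc ∧ ∃ M : ℝ, ∀ z ∈ unitDisc, ‖F z‖ ≤ M

/-- `F` belongs to `QA` with boundary function `Fb`: it is a bounded analytic
function on the disc whose radial boundary values are in VMO. -/
def MemQA (F : ℂ → ℂ) (Fb : ℝ → ℂ) : Prop :=
  MemHinf F ∧ HasRadialLimits F Fb ∧ IsVMO Fb

/-- `E` is an outer function. -/
def IsOuter (E : ℂ → ℂ) : Prop :=
  DifferentiableOn ℂ E unitDisc ∧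
  ∃ h : ℝ → ℝ, IntegrableOn h (Set.Ioc 0 (2 * Real.pi)) ∧ ∀ z ∈ unitDisc,
    E z = Complex.exp (((2 * Real.pi)⁻¹ : ℝ) • ∫ θ in Set.Ioc 0 (2 * Real.pi),
      ((circlePt θ + z) / (circlePt θ - z)) * (h θ : ℂ))

/-- The integral means appearing in the definition of the Hardy space `ℍ^p`. -/
def hardyIntegral (p : ℝ) (F : ℂ → ℂ) (r : ℝ) : ℝ :=
  ∫ θ in Set.Ioc 0 (2 * Real.pi), ‖F ((r : ℂ) * circlePt θ)‖ ^ p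

/-- `F` belongs to the Hardy space `ℍ^p`, `0 < p < ∞`. -/
def MemHardy (p : ℝ) (F : ℂ → ℂ) : Prop :=
  DifferentiableOn ℂ F unitDisc ∧
  ∃ M : ℝ, ∀ r : ℝ, 0 < r → r < 1 → hardyIntegral p F r ≤ M

/-- `F` belongs to `BMOA` with boundary function `Fb`. -/
def MemBMOA (F : ℂ → ℂ) (Fb : ℝ → ℂ) : Prop :=
  MemHardy 2 F ∧ HasRadialLimits F Fb ∧ IsBMO Fb

/-- `F` belongs to `VMOA` with boundary function `Fb`. -/
def MemVMOA (F : ℂ → ℂ) (Fb : ℝ → ℂ) : Prop :=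
  MemHardy 2 F ∧ HasRadialLimits F Fb ∧ IsVMO Fb

/-- The generalized Volterra operator `T_G(F)(z) = ∫₀^z F(w) G'(w) dw`. -/
def volterra (G F : ℂ → ℂ) (z : ℂ) : ℂ :=
  ∫ t in (0:ℝ)..1, z * F ((t : ℂ) * z) * deriv G ((t : ℂ) * z)


/-- `F` belongs to the Bergman-type space `A²₁`. -/
def MemA21 (F : ℂ → ℂ) : Prop :=
  DifferentiableOn ℂ F unitDisc ∧
  IntegrableOn (fun z => ‖F z‖ ^ 2 * (1 - ‖z‖ ^ 2)) unitDisc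

/-- The squared `A²₁` distance between two functions. -/
def a21distSq (F W : ℂ → ℂ) : ℝ :=
  ∫ z in unitDisc, ‖F z - W z‖ ^ 2 * (1 - ‖z‖ ^ 2)

/-- The closure `[F]` in `A²₁` of the polynomial multiples of `F`. -/
def A21closure (F : ℂ → ℂ) : Set (ℂ → ℂ) :=
  {W | MemA21 W ∧ ∀ ε : ℝ, 0 < ε → ∃ P : Polynomial ℂ,
    a21distSq W (fun z => P.eval z * F z) ≤ ε}

section

open scoped ComplexConjugate Pointwise

theorem integral_ball_pow_mul_conj_pow_of_ne {j k : ℕ} (h : j ≠ k) (ω : ℝ → ℝ) :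
    ∫ w in Metric.ball (0 : ℂ) 1, w ^ j * conj w ^ k * (ω ‖w‖ : ℂ) = 0 := by
  set t : ℝ := Real.pi / ((j : ℝ) - k) with ht
  have hjk : ((j : ℝ) - k) ≠ 0 := sub_ne_zero.2 (by exact_mod_cast h)
  set c : Circle := Circle.exp t
  have hc : (c : ℂ) ^ j * conj (c : ℂ) ^ k = -1 := by
    simp only [c, Circle.coe_exp, ← Complex.exp_conj, ← Complex.exp_nat_mul, ← Complex.exp_add]
    rw [← Complex.exp_pi_mul_I]
    congr 1
    simp only [map_mul, Complex.conj_ofReal, Complex.conj_I]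
    have : (t : ℂ) * ((j : ℂ) - k) = Real.pi := by
      rw [ht]; push_cast
      field_simp [show ((j : ℂ) - k) ≠ 0 by exact_mod_cast hjk]
    linear_combination Complex.I * this
  have key := (LinearIsometryEquiv.measurePreserving (rotation c)).setIntegral_preimage_emb
    (rotation c).toHomeomorph.measurableEmbedding
    (fun w : ℂ => w ^ j * conj w ^ k * (ω ‖w‖ : ℂ)) (Metric.ball 0 1)
  have hpre : (rotation c) ⁻¹' (Metric.ball (0 : ℂ) 1) = Metric.ball 0 1 := by
    ext w
    rw [Set.mem_preimage, mem_ball_zero_iff, mem_ball_zero_iff, LinearIsometryEquiv.norm_map]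
  have hfun : (fun w : ℂ => (rotation c w) ^ j * conj (rotation c w) ^ k *
      (ω ‖rotation c w‖ : ℂ)) = fun w => -(w ^ j * conj w ^ k * (ω ‖w‖ : ℂ)) := by
    ext w
    rw [LinearIsometryEquiv.norm_map]
    simp only [rotation_apply, map_mul, mul_pow]
    linear_combination (w ^ j * conj w ^ k * (ω ‖w‖ : ℂ)) * hc
  rw [hpre, hfun, integral_neg] at key
  exact self_eq_neg.1 key.symm

theorem integral_ball_norm_pow (m : ℕ) :
    ∫ w in Metric.ball (0 : ℂ) 1, ‖w‖ ^ (2 * m) = Real.pi / (m + 1) := by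
  have h1 : ∫ w in Metric.ball (0 : ℂ) 1, ‖w‖ ^ (2 * m) =
      ∫ w : ℂ, (Set.Iio (1 : ℝ)).indicator (fun r => r ^ (2 * m)) ‖w‖ := by
    rw [← integral_indicator Metric.isOpen_ball.measurableSet]
    congr 1; ext w
    simp [Set.indicator]
  rw [h1, integral_fun_norm_addHaar]
  have h2 : ∫ y in Set.Ioi (0 : ℝ), y ^ (Module.finrank ℝ ℂ - 1) •
      (Set.Iio (1 : ℝ)).indicator (fun r => r ^ (2 * m)) y = 1 / (2 * m + 2) := by
    have : ∀ y : ℝ, y ^ (Module.finrank ℝ ℂ - 1) •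
      (Set.Iio (1 : ℝ)).indicator (fun r => r ^ (2 * m)) y =
      (Set.Iio (1 : ℝ)).indicator (fun r => r ^ (2 * m + 1)) y := by
      intro y
      simp only [Complex.finrank_real_complex, Set.indicator, smul_eq_mul]
      split_ifs <;> ring
    simp_rw [this]
    rw [setIntegral_indicator measurableSet_Iio, Set.Ioi_inter_Iio,
      ← integral_Ioc_eq_integral_Ioo, ← intervalIntegral.integral_of_le zero_le_one, integral_pow]
    push_cast; simp; ring
  rw [h2]
  have : (volume : Measure ℂ).real (Metric.ball 0 1) = Real.pi := by
    simp [Measure.real, Complex.volume_ball]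
  rw [this]
  simp only [Complex.finrank_real_complex, smul_eq_mul, nsmul_eq_mul]
  field_simp
  push_cast; ring

theorem summable_mul_pow {a : ℕ → ℂ} (ha : Summable fun k => ‖a k‖) {w : ℂ} (hw : ‖w‖ ≤ 1) :
    Summable fun k => ‖a k * w ^ k‖ := by
  refine ha.of_nonneg_of_le (fun _ => norm_nonneg _) fun k => ?_
  rw [norm_mul, norm_pow]
  exact mul_le_of_le_one_right (norm_nonneg _) (pow_le_one₀ (norm_nonneg _) hw)

/-- Orthogonality of power series on the disc with respect to a radial weight. -/
theorem hasSum_integral_ball_mul_conj {a b : ℕ → ℂ} (ha : Summable fun k => ‖a k‖)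
    (hb : Summable fun k => ‖b k‖) {ω : ℝ → ℝ} (hω : Continuous ω)
    (hω1 : ∀ r, 0 ≤ r → r < 1 → |ω r| ≤ 1) {m : ℕ → ℝ}
    (hm : ∀ k, ∫ w in Metric.ball (0 : ℂ) 1, ‖w‖ ^ (2 * k) * ω ‖w‖ = m k) :
    HasSum (fun k => a k * conj (b k) * (m k : ℂ))
      (∫ w in Metric.ball (0 : ℂ) 1,
        (∑' k, a k * w ^ k) * conj (∑' k, b k * w ^ k) * (ω ‖w‖ : ℂ)) := by
  set F : ℕ × ℕ → ℂ → ℂ := fun p w =>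
    a p.1 * w ^ p.1 * (conj (b p.2) * conj w ^ p.2) * (ω ‖w‖ : ℂ) with hF
  have hbound : ∀ p, ∀ w ∈ Metric.ball (0 : ℂ) 1, ‖F p w‖ ≤ ‖a p.1‖ * ‖b p.2‖ := by
    intro p w hw
    have hw' : ‖w‖ < 1 := by simpa using hw
    simp only [hF, norm_mul, norm_pow, RCLike.norm_conj, Complex.norm_real, Real.norm_eq_abs]
    have h1 := pow_le_one₀ (norm_nonneg w) hw'.le (n := p.1)
    have h2 := pow_le_one₀ (norm_nonneg w) hw'.le (n := p.2)
    have h3 := hω1 _ (norm_nonneg w) hw'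
    calc ‖a p.1‖ * ‖w‖ ^ p.1 * (‖b p.2‖ * ‖w‖ ^ p.2) * |ω ‖w‖|
        ≤ ‖a p.1‖ * 1 * (‖b p.2‖ * 1) * 1 := by gcongr
      _ = _ := by ring
  have hcont : ∀ p, Continuous (F p) := fun p => by
    simp only [hF]; fun_prop
  have hfin : volume (Metric.ball (0 : ℂ) 1) ≠ ⊤ := measure_ball_lt_top.ne
  have hint : ∀ p, Integrable (F p) (volume.restrict (Metric.ball (0 : ℂ) 1)) := fun p =>
    Measure.integrableOn_of_bounded hfin (hcont p).aestronglyMeasurable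
      ((ae_restrict_iff' Metric.isOpen_ball.measurableSet).2 (ae_of_all _ (hbound p)))
  have hsum : Summable fun p : ℕ × ℕ => ‖a p.1‖ * ‖b p.2‖ :=
    ha.mul_of_nonneg hb (fun _ => norm_nonneg _) (fun _ => norm_nonneg _)
  have hsumint : Summable fun p => ∫ w in Metric.ball (0 : ℂ) 1, ‖F p w‖ := by
    refine (hsum.mul_right Real.pi).of_nonneg_of_le (fun p => by positivity) fun p => ?_
    calc ∫ w in Metric.ball (0 : ℂ) 1, ‖F p w‖
        ≤ ∫ w in Metric.ball (0 : ℂ) 1, ‖a p.1‖ * ‖b p.2‖ :=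
          setIntegral_mono_on (hint p).norm (integrableOn_const hfin)
            Metric.isOpen_ball.measurableSet (hbound p)
      _ = ‖a p.1‖ * ‖b p.2‖ * Real.pi := by
          simp [Measure.real, Complex.volume_ball, mul_comm]
  have key := hasSum_integral_of_summable_integral_norm hint hsumint
  have hpt : ∫ w in Metric.ball (0 : ℂ) 1, ∑' p, F p w = ∫ w in Metric.ball (0 : ℂ) 1,
        (∑' k, a k * w ^ k) * conj (∑' k, b k * w ^ k) * (ω ‖w‖ : ℂ) := by
    refine setIntegral_congr_fun Metric.isOpen_ball.measurableSet fun w hw => ?_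
    have hw' : ‖w‖ ≤ 1 := (by simpa using hw : ‖w‖ < 1).le
    have hs1 := summable_mul_pow ha hw'
    have hs2 := summable_mul_pow hb hw'
    simp only [hF]
    rw [tsum_mul_right]
    congr 1
    rw [Complex.conj_tsum, tsum_mul_tsum_of_summable_norm hs1 (by simpa using hs2)]
    simp
  rw [hpt] at key
  have hinj : Function.Injective fun k : ℕ => (k, k) := fun x y h => (Prod.mk.inj h).1
  have hval : ∀ p : ℕ × ℕ, ∫ w in Metric.ball (0 : ℂ) 1, F p w =
      a p.1 * conj (b p.2) * ∫ w in Metric.ball (0 : ℂ) 1, w ^ p.1 * conj w ^ p.2 * (ω ‖w‖ : ℂ) := by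
    intro p
    rw [← integral_const_mul]
    congr 1; ext w; simp only [hF]; ring
  rw [← hinj.hasSum_iff] at key
  · suffices h : (fun k => a k * conj (b k) * (m k : ℂ)) =
        (fun p => ∫ w in Metric.ball (0 : ℂ) 1, F p w) ∘ fun k : ℕ => (k, k) by
      rw [h]; exact key
    ext k
    rw [Function.comp_apply, hval]
    congr 1
    rw [← hm k, ← integral_complex_ofReal]
    congr 1; ext w
    push_cast
    rw [← mul_pow, Complex.mul_conj, Complex.normSq_eq_norm_sq]
    push_cast
    ring
  · rintro ⟨j, k⟩ hjk
    rw [hval, integral_ball_pow_mul_conj_pow_of_ne, mul_zero]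
    intro h
    exact hjk ⟨j, Prod.ext rfl h⟩

theorem hasSum_integral_ball_mul_conj_weight {a b : ℕ → ℂ} (ha : Summable fun k => ‖a k‖)
    (hb : Summable fun k => ‖b k‖) :
    HasSum (fun k : ℕ => a k * conj (b k) * ((Real.pi / ((k + 1) * (k + 2)) : ℝ) : ℂ))
      (∫ w in Metric.ball (0 : ℂ) 1,
        (∑' k, a k * w ^ k) * conj (∑' k, b k * w ^ k) * ((1 - ‖w‖ ^ 2 : ℝ) : ℂ)) := by
  refine hasSum_integral_ball_mul_conj ha hb (ω := fun r => 1 - r ^ 2) (by fun_prop) ?_ ?_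
  · intro r h0 h1
    rw [abs_le]; constructor <;> nlinarith
  · intro k
    have hI : ∀ n : ℕ, IntegrableOn (fun w : ℂ => ‖w‖ ^ n) (Metric.ball 0 1) := fun n =>
      ((by fun_prop : Continuous fun w : ℂ => ‖w‖ ^ n).continuousOn.integrableOn_compact
        (isCompact_closedBall 0 1)).mono_set Metric.ball_subset_closedBall
    have : ∀ w : ℂ, ‖w‖ ^ (2 * k) * (1 - ‖w‖ ^ 2) = ‖w‖ ^ (2 * k) - ‖w‖ ^ (2 * (k + 1)) := by
      intro w; ring
    simp_rw [this]
    rw [integral_sub (hI _) (hI _), integral_ball_norm_pow, integral_ball_norm_pow]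
    push_cast
    field_simp
    ring

/-- The Taylor coefficients of `f` at the origin. -/
def taylorCoeff (f : ℂ → ℂ) (k : ℕ) : ℂ := (k.factorial : ℂ)⁻¹ * iteratedDeriv k f 0

theorem hasSum_taylorCoeff {f : ℂ → ℂ} {R : ℝ} (hf : DifferentiableOn ℂ f (Metric.ball 0 R))
    {w : ℂ} (hw : ‖w‖ < R) : HasSum (fun k => taylorCoeff f k * w ^ k) (f w) := by
  have := Complex.hasSum_taylorSeries_on_ball hf (z := w) (by simpa using hw)
  have e : (fun k => taylorCoeff f k * w ^ k) =
      fun n => (n.factorial : ℂ)⁻¹ • (w - 0) ^ n • iteratedDeriv n f 0 := by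
    ext k
    simp only [taylorCoeff, smul_eq_mul, sub_zero]
    ring
  rw [e]
  exact this

theorem summable_norm_taylorCoeff {f : ℂ → ℂ} {R : ℝ}
    (hf : DifferentiableOn ℂ f (Metric.ball 0 R)) (hR : 1 < R) :
    Summable fun k => ‖taylorCoeff f k‖ := by
  have := (hasSum_taylorCoeff hf (w := 1) (by simpa using hR)).summable.norm
  simpa using this

theorem taylorCoeff_zero (f : ℂ → ℂ) : taylorCoeff f 0 = f 0 := by simp [taylorCoeff]

theorem taylorCoeff_deriv (f : ℂ → ℂ) (k : ℕ) :
    taylorCoeff (deriv f) k = (k + 1) * taylorCoeff f (k + 1) := by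
  have h : ((k : ℂ) + 1) ≠ 0 := by exact_mod_cast k.succ_ne_zero
  have h2 : (k.factorial : ℂ) ≠ 0 := by exact_mod_cast k.factorial_ne_zero
  simp only [taylorCoeff, ← iteratedDeriv_succ', Nat.factorial_succ]
  push_cast
  field_simp

/-- Analytic functions near the closed disc with bounded imaginary part have square summable
Taylor coefficients. -/
theorem sum_sq_taylorCoeff_le {L : ℂ → ℂ} {R V : ℝ} (hR : 1 < R)
    (hL : DifferentiableOn ℂ L (Metric.ball 0 R))
    (hV : ∀ w ∈ Metric.ball (0 : ℂ) 1, |(L w).im| ≤ V) (M : ℕ) :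
    ∑ k ∈ Finset.range M, ‖taylorCoeff L k‖ ^ 2 ≤ ‖L 0‖ ^ 2 + 2 * V ^ 2 := by
  have ha := summable_norm_taylorCoeff hL hR
  have hL2 : DifferentiableOn ℂ (fun w => L w ^ 2) (Metric.ball 0 R) := hL.pow 2
  have ha2 := summable_norm_taylorCoeff hL2 hR
  have hcL : ContinuousOn L (Metric.closedBall 0 1) :=
    hL.continuousOn.mono (Metric.closedBall_subset_ball hR)
  have hball : ∀ w ∈ Metric.ball (0 : ℂ) 1, ‖w‖ < R := fun w hw =>
    (by simpa using hw : ‖w‖ < 1).trans hR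
  have hb : Summable fun k => ‖(if k = 0 then 1 else 0 : ℂ)‖ :=
    summable_of_ne_finset_zero (s := {0}) (by intro k hk; simp_all)
  have hmean : ∀ N : ℕ, ∑ k ∈ Finset.range M, ‖taylorCoeff L k‖ ^ 2 * (Real.pi / (k + N + 1)) ≤
      (‖L 0‖ ^ 2 + 2 * V ^ 2) * (Real.pi / (N + 1)) := by
    intro N
    have hm : ∀ k : ℕ, ∫ w in Metric.ball (0 : ℂ) 1, ‖w‖ ^ (2 * k) * ‖w‖ ^ (2 * N) =
        Real.pi / (k + N + 1) := by
      intro k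
      have := integral_ball_norm_pow (k + N)
      simp_rw [mul_add, pow_add] at this
      rw [this]; push_cast; rfl
    have hω1 : ∀ r : ℝ, 0 ≤ r → r < 1 → |r ^ (2 * N)| ≤ 1 := fun r h0 h1 => by
      rw [abs_of_nonneg (by positivity)]; exact pow_le_one₀ h0 h1.le
    have hs1 := hasSum_integral_ball_mul_conj (ω := fun r => r ^ (2 * N)) ha ha (by fun_prop) hω1 hm
    have hs2 := hasSum_integral_ball_mul_conj (ω := fun r => r ^ (2 * N)) ha2 hb (by fun_prop) hω1 hm
    have e1 : ∫ w in Metric.ball (0 : ℂ) 1, (∑' k, taylorCoeff L k * w ^ k) *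
        conj (∑' k, taylorCoeff L k * w ^ k) * ((‖w‖ ^ (2 * N) : ℝ) : ℂ) =
        ((∫ w in Metric.ball (0 : ℂ) 1, ‖L w‖ ^ 2 * ‖w‖ ^ (2 * N) : ℝ) : ℂ) := by
      rw [← integral_complex_ofReal]
      refine setIntegral_congr_fun Metric.isOpen_ball.measurableSet fun w hw => ?_
      rw [(hasSum_taylorCoeff hL (hball w hw)).tsum_eq, Complex.mul_conj,
        Complex.normSq_eq_norm_sq]
      push_cast; rfl
    have e2 : ∫ w in Metric.ball (0 : ℂ) 1,
        (∑' k, taylorCoeff (fun w => L w ^ 2) k * w ^ k) *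
        conj (∑' k, (if k = 0 then 1 else 0 : ℂ) * w ^ k) * ((‖w‖ ^ (2 * N) : ℝ) : ℂ) =
        ∫ w in Metric.ball (0 : ℂ) 1, L w ^ 2 * ((‖w‖ ^ (2 * N) : ℝ) : ℂ) := by
      refine setIntegral_congr_fun Metric.isOpen_ball.measurableSet fun w hw => ?_
      rw [(hasSum_taylorCoeff hL2 (hball w hw)).tsum_eq,
        tsum_eq_single 0 (by intro k hk; simp [hk])]
      simp
    rw [e1] at hs1
    rw [e2] at hs2
    have hs1' : HasSum (fun k : ℕ => ‖taylorCoeff L k‖ ^ 2 * (Real.pi / (k + N + 1)))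
        (∫ w in Metric.ball (0 : ℂ) 1, ‖L w‖ ^ 2 * ‖w‖ ^ (2 * N)) := by
      rw [← Complex.hasSum_ofReal]
      convert hs1 using 2 with k
      rw [Complex.mul_conj, Complex.normSq_eq_norm_sq]
      push_cast; rfl
    have hv2 : ∫ w in Metric.ball (0 : ℂ) 1, L w ^ 2 * ((‖w‖ ^ (2 * N) : ℝ) : ℂ) =
        L 0 ^ 2 * ((Real.pi / (N + 1) : ℝ) : ℂ) := by
      rw [← hs2.tsum_eq, tsum_eq_single 0 (by intro k hk; simp [hk]), taylorCoeff_zero]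
      simp
    have hint : ∀ g : ℂ → ℝ, ContinuousOn g (Metric.closedBall 0 1) →
        IntegrableOn g (Metric.ball 0 1) := fun g hg =>
      (hg.integrableOn_compact (isCompact_closedBall 0 1)).mono_set Metric.ball_subset_closedBall
    have hintC : ∀ g : ℂ → ℂ, ContinuousOn g (Metric.closedBall 0 1) →
        IntegrableOn g (Metric.ball 0 1) := fun g hg =>
      (hg.integrableOn_compact (isCompact_closedBall 0 1)).mono_set Metric.ball_subset_closedBall
    have hre : ∫ w in Metric.ball (0 : ℂ) 1, (L w ^ 2).re * ‖w‖ ^ (2 * N) =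
        (L 0 ^ 2 * ((Real.pi / (N + 1) : ℝ) : ℂ)).re := by
      rw [← hv2]
      have := integral_re (hintC (fun w => L w ^ 2 * ((‖w‖ ^ (2 * N) : ℝ) : ℂ)) (by fun_prop))
      simp only [RCLike.re_to_complex] at this
      rw [← this]
      congr 1; ext w
      rw [Complex.re_mul_ofReal]
    have hbd : ∫ w in Metric.ball (0 : ℂ) 1, ‖L w‖ ^ 2 * ‖w‖ ^ (2 * N) ≤
        ∫ w in Metric.ball (0 : ℂ) 1,
          (2 * V ^ 2 * ‖w‖ ^ (2 * N) + (L w ^ 2).re * ‖w‖ ^ (2 * N)) := by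
      refine setIntegral_mono_on (hint _ (by fun_prop)) (hint _ ?_)
        Metric.isOpen_ball.measurableSet fun w hw => ?_
      · have : ContinuousOn (fun w => (L w ^ 2).re) (Metric.closedBall 0 1) :=
          Complex.continuous_re.comp_continuousOn (by fun_prop)
        fun_prop
      · rw [← add_mul]
        refine mul_le_mul_of_nonneg_right ?_ (by positivity)
        have h1 := hV w hw
        have h2 : (L w).im ^ 2 ≤ V ^ 2 := sq_le_sq' (by linarith [abs_le.1 h1]) (abs_le.1 h1).2
        rw [← Complex.normSq_eq_norm_sq, Complex.normSq_apply, pow_two (L w), Complex.mul_re]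
        nlinarith
    have hcre : ContinuousOn (fun w => (L w ^ 2).re) (Metric.closedBall 0 1) :=
      Complex.continuous_re.comp_continuousOn (by fun_prop)
    rw [integral_add (hint _ (by fun_prop)) (hint _ (by fun_prop)), hre, integral_const_mul,
      integral_ball_norm_pow, Complex.re_mul_ofReal] at hbd
    have h3 : (L 0 ^ 2).re ≤ ‖L 0‖ ^ 2 := (Complex.re_le_norm _).trans (by rw [norm_pow])
    have h4 : 0 < Real.pi / (N + 1) := by positivity
    calc _ ≤ _ := sum_le_hasSum _ (fun k _ => by positivity) hs1'
      _ ≤ _ := hbd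
      _ ≤ _ := by nlinarith
  have hlim : Tendsto (fun N : ℕ => ∑ k ∈ Finset.range M,
      ‖taylorCoeff L k‖ ^ 2 * (((N : ℝ) + 1) / (k + N + 1))) atTop
      (𝓝 (∑ k ∈ Finset.range M, ‖taylorCoeff L k‖ ^ 2 * 1)) := by
    refine tendsto_finsetSum _ fun k _ => Tendsto.const_mul _ ?_
    have : Tendsto (fun N : ℕ => 1 - (k : ℝ) * ((N + k : ℕ) + 1 : ℝ)⁻¹) atTop (𝓝 (1 - k * 0)) :=
      (((tendsto_add_atTop_iff_nat k).2 tendsto_one_div_add_atTop_nhds_zero_nat).congr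
        (fun n => by rw [one_div])).const_mul _ |>.const_sub _
    rw [mul_zero, sub_zero] at this
    refine this.congr fun N => ?_
    have : (k : ℝ) + N + 1 ≠ 0 := by positivity
    have h' : (N : ℝ) + k + 1 ≠ 0 := by positivity
    push_cast
    field_simp
    ring
  simp only [mul_one] at hlim
  refine le_of_tendsto' hlim fun N => ?_
  have h := hmean N
  have hN : (0 : ℝ) < (N + 1) / Real.pi := by positivity
  have h' := mul_le_mul_of_nonneg_right h hN.le
  have e : (‖L 0‖ ^ 2 + 2 * V ^ 2) * (Real.pi / (N + 1)) * ((N + 1) / Real.pi) =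
      ‖L 0‖ ^ 2 + 2 * V ^ 2 := by
    have := Real.pi_pos.ne'
    field_simp
  rw [e, Finset.sum_mul] at h'
  refine le_trans (le_of_eq (Finset.sum_congr rfl fun k _ => ?_)) h'
  have := Real.pi_pos.ne'
  field_simp

/-- A Littlewood–Paley estimate. -/
theorem integral_norm_deriv_sq_le {L : ℂ → ℂ} {R V : ℝ} (hR : 1 < R)
    (hL : DifferentiableOn ℂ L (Metric.ball 0 R))
    (hV : ∀ w ∈ Metric.ball (0 : ℂ) 1, |(L w).im| ≤ V) :
    ∫ w in Metric.ball (0 : ℂ) 1, ‖deriv L w‖ ^ 2 * (1 - ‖w‖ ^ 2) ≤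
      Real.pi * (‖L 0‖ ^ 2 + 2 * V ^ 2) := by
  have hL' : DifferentiableOn ℂ (deriv L) (Metric.ball 0 R) := hL.deriv Metric.isOpen_ball
  have ha := summable_norm_taylorCoeff hL' hR
  have hs := hasSum_integral_ball_mul_conj_weight ha ha
  have e1 : ∫ w in Metric.ball (0 : ℂ) 1, (∑' k, taylorCoeff (deriv L) k * w ^ k) *
      conj (∑' k, taylorCoeff (deriv L) k * w ^ k) * ((1 - ‖w‖ ^ 2 : ℝ) : ℂ) =
      ((∫ w in Metric.ball (0 : ℂ) 1, ‖deriv L w‖ ^ 2 * (1 - ‖w‖ ^ 2) : ℝ) : ℂ) := by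
    rw [← integral_complex_ofReal]
    refine setIntegral_congr_fun Metric.isOpen_ball.measurableSet fun w hw => ?_
    rw [(hasSum_taylorCoeff hL' ((by simpa using hw : ‖w‖ < 1).trans hR)).tsum_eq,
      Complex.mul_conj, Complex.normSq_eq_norm_sq]
    push_cast; rfl
  rw [e1] at hs
  have hs' : HasSum (fun k : ℕ => ‖taylorCoeff (deriv L) k‖ ^ 2 *
      (Real.pi / ((k + 1) * (k + 2))))
      (∫ w in Metric.ball (0 : ℂ) 1, ‖deriv L w‖ ^ 2 * (1 - ‖w‖ ^ 2)) := by
    rw [← Complex.hasSum_ofReal]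
    convert hs using 2 with k
    rw [Complex.mul_conj, Complex.normSq_eq_norm_sq]
    push_cast; rfl
  rw [← hs'.tsum_eq]
  refine Real.tsum_le_of_sum_range_le (fun k => by positivity) fun M => ?_
  have hb := sum_sq_taylorCoeff_le hR hL hV (M + 1)
  rw [Finset.sum_range_succ'] at hb
  calc _ ≤ ∑ k ∈ Finset.range M, Real.pi * ‖taylorCoeff L (k + 1)‖ ^ 2 := by
        refine Finset.sum_le_sum fun k _ => ?_
        rw [taylorCoeff_deriv, norm_mul]
        have : ‖((k : ℂ) + 1)‖ = k + 1 := by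
          rw [← Nat.cast_succ, Complex.norm_natCast]; push_cast; rfl
        rw [this]
        have h0 : ((k : ℝ) + 1) ^ 2 / ((k + 1) * (k + 2)) ≤ 1 := by
          rw [div_le_one (by positivity)]; nlinarith
        calc _ = Real.pi * ‖taylorCoeff L (k + 1)‖ ^ 2 *
              (((k : ℝ) + 1) ^ 2 / ((k + 1) * (k + 2))) := by ring
          _ ≤ _ := mul_le_of_le_one_right (by positivity) h0
    _ = Real.pi * ∑ k ∈ Finset.range M, ‖taylorCoeff L (k + 1)‖ ^ 2 := by rw [Finset.mul_sum]
    _ ≤ _ := mul_le_mul_of_nonneg_left (by nlinarith [sq_nonneg ‖taylorCoeff L 0‖])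
        Real.pi_pos.le

theorem integral_ball_mul_conj_kernel {Φ : ℂ → ℂ} {R : ℝ} (hR : 1 < R)
    (hΦ : DifferentiableOn ℂ Φ (Metric.ball 0 R)) {z : ℂ} (hz : ‖z‖ < 1) :
    ∫ w in Metric.ball (0 : ℂ) 1, Φ w * conj (conj z / (1 - conj z * w) ^ 2) *
        ((1 - ‖w‖ ^ 2 : ℝ) : ℂ) =
      Real.pi * ∫ s in (0 : ℝ)..1, (z * s) * Φ (z * s) := by
  have ha := summable_norm_taylorCoeff hΦ hR
  set b : ℕ → ℂ := fun k => (k + 1) * conj z ^ (k + 1) with hb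
  have hgeo : ∀ r : ℂ, ‖r‖ < 1 → HasSum (fun n : ℕ => ((n : ℂ) + 1) * r ^ n) (1 / (1 - r) ^ 2) := by
    intro r hr
    have := hasSum_choose_mul_geometric_of_norm_lt_one 1 hr
    simpa using this
  have hbs : Summable fun k => ‖b k‖ := by
    have := ((hgeo (conj z) (by simpa using hz)).mul_left (conj z)).summable.norm
    refine this.congr fun k => ?_
    congr 1; simp only [hb]; ring
  have hbw : ∀ w ∈ Metric.ball (0 : ℂ) 1, ∑' k, b k * w ^ k = conj z / (1 - conj z * w) ^ 2 := by
    intro w hw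
    have hw' : ‖w‖ < 1 := by simpa using hw
    have h1 : ‖conj z * w‖ < 1 := by
      rw [norm_mul, RCLike.norm_conj]
      exact mul_lt_one_of_nonneg_of_lt_one_left (norm_nonneg _) hz hw'.le
    have := (hgeo _ h1).mul_left (conj z)
    rw [← mul_one_div, ← this.tsum_eq]
    congr 1; ext k; simp only [hb]; ring
  have hs := hasSum_integral_ball_mul_conj_weight ha hbs
  have e1 : ∫ w in Metric.ball (0 : ℂ) 1, (∑' k, taylorCoeff Φ k * w ^ k) *
      conj (∑' k, b k * w ^ k) * ((1 - ‖w‖ ^ 2 : ℝ) : ℂ) =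
      ∫ w in Metric.ball (0 : ℂ) 1, Φ w * conj (conj z / (1 - conj z * w) ^ 2) *
        ((1 - ‖w‖ ^ 2 : ℝ) : ℂ) := by
    refine setIntegral_congr_fun Metric.isOpen_ball.measurableSet fun w hw => ?_
    simp only [hbw w hw]
    rw [(hasSum_taylorCoeff hΦ ((by simpa using hw : ‖w‖ < 1).trans hR)).tsum_eq]
  rw [e1] at hs
  have hzs : ∀ s ∈ Set.uIoc (0 : ℝ) 1, ‖z * s‖ ≤ 1 := by
    intro s hs
    rw [Set.uIoc_of_le zero_le_one] at hs
    rw [norm_mul, Complex.norm_real, Real.norm_eq_abs, abs_of_pos hs.1]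
    nlinarith [hs.1, hs.2, norm_nonneg z]
  have ht : HasSum (fun k : ℕ => ∫ s in (0 : ℝ)..1,
      taylorCoeff Φ k * z ^ (k + 1) * (s : ℂ) ^ (k + 1))
      (∫ s in (0 : ℝ)..1, (z * s) * Φ (z * s)) := by
    refine intervalIntegral.hasSum_integral_of_dominated_convergence
      (fun k _ => ‖taylorCoeff Φ k‖) ?_ ?_ ?_ ?_ ?_
    · intro k
      exact (by fun_prop : Continuous fun s : ℝ =>
        taylorCoeff Φ k * z ^ (k + 1) * (s : ℂ) ^ (k + 1)).aestronglyMeasurable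
    · refine fun k => ae_of_all _ fun s hs => ?_
      rw [mul_assoc, ← mul_pow, norm_mul, norm_pow]
      exact mul_le_of_le_one_right (norm_nonneg _) (pow_le_one₀ (norm_nonneg _) (hzs s hs))
    · exact ae_of_all _ fun s _ => ha
    · exact intervalIntegrable_const
    · refine ae_of_all _ fun s hs => ?_
      have := (hasSum_taylorCoeff hΦ ((hzs s hs).trans_lt hR)).mul_left (z * s)
      have e : (fun k => taylorCoeff Φ k * z ^ (k + 1) * (s : ℂ) ^ (k + 1)) =
          fun k => (z * s) * (taylorCoeff Φ k * (z * s) ^ k) := by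
        ext k; ring
      rw [e]; exact this
  rw [← hs.tsum_eq, ← (ht.mul_left (Real.pi : ℂ)).tsum_eq]
  congr 1; ext k
  have hi : ∫ s in (0 : ℝ)..1, taylorCoeff Φ k * z ^ (k + 1) * (s : ℂ) ^ (k + 1) =
      taylorCoeff Φ k * z ^ (k + 1) * (1 / (k + 2)) := by
    rw [intervalIntegral.integral_const_mul]
    congr 1
    have : ∀ s : ℝ, (s : ℂ) ^ (k + 1) = ((s ^ (k + 1) : ℝ) : ℂ) := fun s => by push_cast; rfl
    simp_rw [this]
    rw [intervalIntegral.integral_ofReal, integral_pow]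
    push_cast; simp; ring
  rw [hi]
  simp only [hb, map_mul, map_add, map_pow, Complex.conj_conj, map_natCast, map_one]
  have h1 : (k : ℂ) + 1 ≠ 0 := by exact_mod_cast k.succ_ne_zero
  have h2 : (k : ℂ) + 2 ≠ 0 := by exact_mod_cast (k + 1).succ_ne_zero
  push_cast
  field_simp

theorem cpow_half_sector {a : ℂ} (ha : 0 < a.re) :
    (a ^ (1 / 2 : ℂ)) ^ 2 = a ∧ |(a ^ (1 / 2 : ℂ)).im| ≤ (a ^ (1 / 2 : ℂ)).re := by
  have ha0 : a ≠ 0 := by rintro rfl; simp at ha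
  have hsq : (a ^ (1 / 2 : ℂ)) ^ 2 = a := by
    rw [← Complex.cpow_nat_mul]; simp
  refine ⟨hsq, ?_⟩
  have hre : 0 ≤ (a ^ (1 / 2 : ℂ)).re := by
    rw [Complex.cpow_def_of_ne_zero ha0, Complex.exp_re]
    refine mul_nonneg (Real.exp_pos _).le (Real.cos_nonneg_of_mem_Icc ?_)
    have h1 : (Complex.log a * (1 / 2)).im = a.arg / 2 := by
      rw [show (1 / 2 : ℂ) = ((1 / 2 : ℝ) : ℂ) by push_cast; rfl, Complex.im_mul_ofReal,
        Complex.log_im]; ring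
    rw [h1]
    constructor <;> linarith [Complex.neg_pi_lt_arg a, Complex.arg_le_pi a]
  refine abs_le_of_sq_le_sq ?_ hre
  have := congrArg Complex.re hsq
  rw [pow_two, Complex.mul_re] at this
  nlinarith

theorem integral_log_deriv_sq_le {φ : ℂ → ℂ} {R : ℝ} (hR : 1 < R)
    (hφ : DifferentiableOn ℂ φ (Metric.ball 0 R)) (hre : ∀ w ∈ Metric.ball (0 : ℂ) R, 0 < (φ w).re)
    {x : ℝ} (hx : φ 0 = x) (hx0 : 0 ≤ x) (hx1 : x ≤ 1) :
    ∫ w in Metric.ball (0 : ℂ) 1, ‖deriv φ w / (1 + φ w)‖ ^ 2 * (1 - ‖w‖ ^ 2) ≤ 20 := by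
  have hslit : ∀ w ∈ Metric.ball (0 : ℂ) R, 1 + φ w ∈ Complex.slitPlane := fun w hw =>
    Or.inl (by have := hre w hw; simp; linarith)
  have hL : DifferentiableOn ℂ (fun w => Complex.log (1 + φ w)) (Metric.ball 0 R) :=
    (hφ.const_add 1).clog hslit
  have hsub : Metric.ball (0 : ℂ) 1 ⊆ Metric.ball 0 R := Metric.ball_subset_ball hR.le
  have h := integral_norm_deriv_sq_le (V := Real.pi / 2) hR hL (fun w hw => by
    rw [Complex.log_im, Complex.abs_arg_le_pi_div_two_iff]
    have := hre w (hsub hw); simp; linarith)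
  have e : ∫ w in Metric.ball (0 : ℂ) 1, ‖deriv φ w / (1 + φ w)‖ ^ 2 * (1 - ‖w‖ ^ 2) =
      ∫ w in Metric.ball (0 : ℂ) 1,
        ‖deriv (fun w => Complex.log (1 + φ w)) w‖ ^ 2 * (1 - ‖w‖ ^ 2) := by
    refine setIntegral_congr_fun Metric.isOpen_ball.measurableSet fun w hw => ?_
    have hd : HasDerivAt φ (deriv φ w) w :=
      (hφ.differentiableAt (Metric.isOpen_ball.mem_nhds (hsub hw))).hasDerivAt
    rw [((hd.const_add 1).clog (hslit w (hsub hw))).deriv]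
  rw [e]
  refine h.trans ?_
  have h0 : ‖Complex.log (1 + φ 0)‖ ≤ 1 := by
    rw [hx, ← Complex.ofReal_one, ← Complex.ofReal_add, ← Complex.ofReal_log (by linarith),
      Complex.norm_real, Real.norm_eq_abs, abs_of_nonneg (Real.log_nonneg (by linarith))]
    linarith [Real.log_le_sub_one_of_pos (show 0 < 1 + x by linarith)]
  have hp := Real.pi_lt_d2
  have hp0 := Real.pi_pos
  have h02 : ‖Complex.log (1 + φ 0)‖ ^ 2 ≤ 1 := pow_le_one₀ (norm_nonneg _) h0
  have hp2 : Real.pi ^ 2 ≤ 3.15 ^ 2 := by gcongr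
  calc Real.pi * (‖Complex.log (1 + φ 0)‖ ^ 2 + 2 * (Real.pi / 2) ^ 2)
      ≤ 3.15 * (1 + 3.15 ^ 2 / 2) := by
        gcongr
        linarith
    _ ≤ 20 := by norm_num

theorem integrableOn_ball_of_continuousOn {E : Type*} [NormedAddCommGroup E] {f : ℂ → E} {R : ℝ}
    (hR : 1 < R) (hf : ContinuousOn f (Metric.ball 0 R)) :
    IntegrableOn f (Metric.ball (0 : ℂ) 1) :=
  ((hf.mono (Metric.closedBall_subset_ball hR)).integrableOn_compact
    (isCompact_closedBall 0 1)).mono_set Metric.ball_subset_closedBall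

theorem norm_integral_pairing_le {E Q H D : ℂ → ℂ} {q : ℝ} (hq : 0 < q)
    (hEH : ∀ w ∈ Metric.ball (0 : ℂ) 1, ‖E w‖ * ‖H w‖ ≤ 2 * ‖D w‖)
    (hDi : IntegrableOn (fun w => ‖D w‖ ^ 2 * (1 - ‖w‖ ^ 2)) (Metric.ball (0 : ℂ) 1))
    (hQi : IntegrableOn (fun w => ‖Q w‖ ^ 2 * (1 - ‖w‖ ^ 2)) (Metric.ball (0 : ℂ) 1))
    (hD : ∫ w in Metric.ball (0 : ℂ) 1, ‖D w‖ ^ 2 * (1 - ‖w‖ ^ 2) ≤ 20)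
    (hQ : ∫ w in Metric.ball (0 : ℂ) 1, ‖Q w‖ ^ 2 * (1 - ‖w‖ ^ 2) ≤ q ^ 2) :
    ‖∫ w in Metric.ball (0 : ℂ) 1, (E w * Q w) * conj (H w) * ((1 - ‖w‖ ^ 2 : ℝ) : ℂ)‖ ≤
      9 * q := by
  have h1 : ‖∫ w in Metric.ball (0 : ℂ) 1, (E w * Q w) * conj (H w) *
      ((1 - ‖w‖ ^ 2 : ℝ) : ℂ)‖ ≤ ∫ w in Metric.ball (0 : ℂ) 1,
        (9 / (2 * q) * (‖Q w‖ ^ 2 * (1 - ‖w‖ ^ 2)) +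
          2 * q / 9 * (‖D w‖ ^ 2 * (1 - ‖w‖ ^ 2))) := by
    refine norm_integral_le_of_norm_le ((hQi.const_mul _).add (hDi.const_mul _)) ?_
    refine (ae_restrict_iff' Metric.isOpen_ball.measurableSet).2 (ae_of_all _ fun w hw => ?_)
    have hw1 : ‖w‖ < 1 := by simpa using hw
    have hpos : 0 ≤ 1 - ‖w‖ ^ 2 := by nlinarith [norm_nonneg w]
    rw [norm_mul, norm_mul, norm_mul, RCLike.norm_conj, Complex.norm_real, Real.norm_eq_abs,
      abs_of_nonneg hpos, ← mul_assoc, ← mul_assoc, ← add_mul]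
    refine mul_le_mul_of_nonneg_right ?_ hpos
    have h2 := hEH w hw
    have h3 : ‖E w‖ * ‖Q w‖ * ‖H w‖ ≤ ‖Q w‖ * (2 * ‖D w‖) := by
      nlinarith [norm_nonneg (Q w)]
    refine h3.trans ?_
    have : 0 ≤ (9 * ‖Q w‖ - 2 * q * ‖D w‖) ^ 2 / (18 * q) := by positivity
    have e : 9 / (2 * q) * ‖Q w‖ ^ 2 + 2 * q / 9 * ‖D w‖ ^ 2 - ‖Q w‖ * (2 * ‖D w‖) =
      (9 * ‖Q w‖ - 2 * q * ‖D w‖) ^ 2 / (18 * q) := by field_simp; ring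
    linarith
  refine h1.trans ?_
  rw [integral_add (hQi.const_mul _) (hDi.const_mul _), integral_const_mul, integral_const_mul]
  calc _ ≤ 9 / (2 * q) * q ^ 2 + 2 * q / 9 * 20 := by gcongr
    _ = 9 / 2 * q + 40 / 9 * q := by field_simp; ring
    _ ≤ 9 * q := by linarith

/-- The multipliers used in the construction: analytic in the disc, bounded by one, with
nonnegative real part and not too small at the origin. -/
def IsMultiplier (E : ℂ → ℂ) : Prop :=
  DifferentiableOn ℂ E (Metric.ball 0 1) ∧ (∀ w ∈ Metric.ball (0 : ℂ) 1, 0 ≤ (E w).re) ∧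
    (∀ w ∈ Metric.ball (0 : ℂ) 1, ‖E w‖ ≤ 1) ∧ 1 / 4 ≤ (E 0).re

theorem exists_isMultiplier_sum_lt {J ι : Type*} [Fintype J] [Fintype ι] {v : J → ℝ}
    (hv : ∀ j, 0 < v j) (hv1 : ∑ j, v j ≤ 1) {Q : J → ℂ → ℂ} (hQ : ∀ j, Differentiable ℂ (Q j))
    (hQn : ∀ j, ∫ w in Metric.ball (0 : ℂ) 1, ‖Q j w‖ ^ 2 * (1 - ‖w‖ ^ 2) ≤ (v j ^ 4 / 20) ^ 2)
    {z : ι → ℂ} (hz : ∀ i, ‖z i‖ < 1) {c : J → ι → ℝ} (hc : ∀ j i, 0 ≤ c j i)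
    (hcv : ∑ j, ∑ i, c j i * v j = 1) :
    ∃ E : ℂ → ℂ, IsMultiplier E ∧
      ∑ j, ∑ i, c j i * (∫ s in (0 : ℝ)..1, (z i * s) * (E (z i * s) * Q j (z i * s))).re < 1 := by
  classical
  obtain ⟨R, hR, hzR⟩ : ∃ R : ℝ, 1 < R ∧ ∀ i, ‖z i‖ * R < 1 := by
    have : ∀ᶠ R : ℝ in 𝓝[>] 1, ∀ i, ‖z i‖ * R < 1 := by
      rw [Filter.eventually_all]
      intro i
      have : Tendsto (fun R : ℝ => ‖z i‖ * R) (𝓝[>] 1) (𝓝 (‖z i‖ * 1)) :=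
        (tendsto_id.const_mul _).mono_left nhdsWithin_le_nhds
      exact this.eventually_lt_const (by simpa using hz i)
    obtain ⟨R, h1, h2⟩ := (this.and self_mem_nhdsWithin).exists
    exact ⟨R, h2, h1⟩
  have hsub : Metric.ball (0 : ℂ) 1 ⊆ Metric.ball 0 R := Metric.ball_subset_ball hR.le
  have hv1' : ∀ j, v j ≤ 1 := fun j =>
    (Finset.single_le_sum (fun j _ => (hv j).le) (Finset.mem_univ j)).trans hv1
  have hcj : ∀ j, (∑ i, c j i) * v j ≤ 1 := fun j => by
    rw [Finset.sum_mul, ← hcv]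
    exact Finset.single_le_sum (f := fun j => ∑ i, c j i * v j)
      (fun j _ => Finset.sum_nonneg fun i _ => mul_nonneg (hc j i) (hv j).le) (Finset.mem_univ j)
  set κ : ι → ℂ → ℂ := fun i w => 1 / (1 - conj (z i) * w) with hκ
  have hden : ∀ i, ∀ w ∈ Metric.ball (0 : ℂ) R, 0 < (1 - conj (z i) * w).re := by
    intro i w hw
    have hw' : ‖w‖ < R := by simpa using hw
    have h1 : (conj (z i) * w).re ≤ ‖z i‖ * ‖w‖ := by
      refine (Complex.re_le_norm _).trans ?_
      rw [norm_mul, RCLike.norm_conj]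
    have h2 : ‖z i‖ * ‖w‖ ≤ ‖z i‖ * R := by gcongr
    rw [Complex.sub_re, Complex.one_re]
    linarith [hzR i]
  have hden0 : ∀ i, ∀ w ∈ Metric.ball (0 : ℂ) R, (1 - conj (z i) * w) ≠ 0 := by
    intro i w hw h
    have := hden i w hw
    rw [h] at this; simp at this
  have hκd : ∀ i, ∀ w ∈ Metric.ball (0 : ℂ) R,
      HasDerivAt (κ i) (conj (z i) / (1 - conj (z i) * w) ^ 2) w := by
    intro i w hw
    have h := (((hasDerivAt_id w).const_mul (conj (z i))).const_sub 1).inv (hden0 i w hw)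
    have e : κ i = fun y => (1 - conj (z i) * y)⁻¹ := by ext y; simp [hκ]
    rw [e]
    refine HasDerivAt.congr_deriv h ?_
    rw [mul_one, neg_neg]
    rfl
  have hκre : ∀ i, ∀ w ∈ Metric.ball (0 : ℂ) R, 0 ≤ (κ i w).re := by
    intro i w hw
    simp only [hκ, one_div, Complex.inv_re]
    exact div_nonneg (hden i w hw).le (Complex.normSq_nonneg _)
  set η : J → ℝ := fun j => v j ^ 3 / 2 with hη
  have hηpos : ∀ j, 0 < η j := fun j => by have := hv j; positivity
  set φ : J → ℂ → ℂ := fun j w => η j * (1 + ∑ i, c j i * κ i w) with hφ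
  have hφd : ∀ j, ∀ w ∈ Metric.ball (0 : ℂ) R, HasDerivAt (φ j)
      (η j * ∑ i, c j i * (conj (z i) / (1 - conj (z i) * w) ^ 2)) w := by
    intro j w hw
    exact ((HasDerivAt.fun_sum fun i _ => (hκd i w hw).const_mul _).const_add 1).const_mul _
  have hφD : ∀ j, DifferentiableOn ℂ (φ j) (Metric.ball 0 R) := fun j w hw =>
    (hφd j w hw).differentiableAt.differentiableWithinAt
  have hφre : ∀ j, ∀ w ∈ Metric.ball (0 : ℂ) R, 0 < (φ j w).re := by
    intro j w hw
    simp only [hφ, Complex.re_ofReal_mul, Complex.add_re, Complex.one_re, Complex.re_sum]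
    have : 0 ≤ ∑ i, c j i * (κ i w).re :=
      Finset.sum_nonneg fun i _ => mul_nonneg (hc j i) (hκre i w hw)
    have := hηpos j
    positivity
  have hφ0 : ∀ j, φ j 0 = ((η j * (1 + ∑ i, c j i) : ℝ) : ℂ) := by
    intro j; simp [hφ, hκ]
  have hx0 : ∀ j, 0 ≤ η j * (1 + ∑ i, c j i) := fun j =>
    mul_nonneg (hηpos j).le (add_nonneg zero_le_one (Finset.sum_nonneg fun i _ => hc j i))
  have hxv : ∀ j, η j * (1 + ∑ i, c j i) ≤ v j ^ 2 := by
    intro j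
    have h1 := hcj j
    have h2 := hv j
    have h3 := hv1' j
    simp only [hη]
    have h4 : v j ^ 2 * (v j + (∑ i, c j i) * v j) ≤ v j ^ 2 * 2 := by gcongr; linarith
    nlinarith
  have hx1 : ∀ j, η j * (1 + ∑ i, c j i) ≤ 1 := fun j =>
    (hxv j).trans (pow_le_one₀ (hv j).le (hv1' j))
  set ψ : J → ℂ → ℂ := fun j w => φ j w ^ (1 / 2 : ℂ) with hψ
  have hψD : ∀ j, DifferentiableOn ℂ (ψ j) (Metric.ball 0 R) := fun j w hw =>
    ((hφD j w hw).cpow_const (Or.inl (hφre j w hw)))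
  have hψs : ∀ j, ∀ w ∈ Metric.ball (0 : ℂ) R, ψ j w ^ 2 = φ j w ∧ |(ψ j w).im| ≤ (ψ j w).re :=
    fun j w hw => cpow_half_sector (hφre j w hw)
  have hψ0 : ∀ j, ψ j 0 = ((Real.sqrt (η j * (1 + ∑ i, c j i)) : ℝ) : ℂ) := by
    intro j
    simp only [hψ]
    rw [hφ0, Real.sqrt_eq_rpow, Complex.ofReal_cpow (hx0 j)]
    push_cast; rfl
  set k : ℂ → ℂ := fun w => 1 + ∑ j, ψ j w with hk
  have hkre : ∀ w, (k w).re = 1 + ∑ j, (ψ j w).re := fun w => by simp [hk]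
  have hkim : ∀ w, (k w).im = ∑ j, (ψ j w).im := fun w => by simp [hk]
  have hψre : ∀ j, ∀ w ∈ Metric.ball (0 : ℂ) R, 0 ≤ (ψ j w).re := fun j w hw =>
    (abs_nonneg _).trans (hψs j w hw).2
  have hk1 : ∀ w ∈ Metric.ball (0 : ℂ) R, 1 ≤ (k w).re := fun w hw => by
    rw [hkre]
    linarith [Finset.sum_nonneg fun j (_ : j ∈ Finset.univ) => hψre j w hw]
  have hkψ : ∀ j, ∀ w ∈ Metric.ball (0 : ℂ) R, 1 + (ψ j w).re ≤ (k w).re := fun j w hw => by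
    rw [hkre]
    linarith [Finset.single_le_sum (f := fun j => (ψ j w).re) (fun j _ => hψre j w hw)
      (Finset.mem_univ j)]
  have hks : ∀ w ∈ Metric.ball (0 : ℂ) R, |(k w).im| ≤ (k w).re := fun w hw => by
    rw [hkim, hkre]
    have := (Finset.abs_sum_le_sum_abs (fun j => (ψ j w).im) Finset.univ).trans
      (Finset.sum_le_sum fun j _ => (hψs j w hw).2)
    linarith
  have hk0 : ∀ w ∈ Metric.ball (0 : ℂ) R, k w ≠ 0 := fun w hw h => by
    have := hk1 w hw
    rw [h] at this; norm_num at this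
  have hkD : DifferentiableOn ℂ k (Metric.ball 0 R) :=
    (DifferentiableOn.fun_sum fun j _ => hψD j).const_add 1
  set E : ℂ → ℂ := fun w => (k w ^ 2)⁻¹ with hE
  have hED : DifferentiableOn ℂ E (Metric.ball 0 R) :=
    (hkD.pow 2).inv fun w hw => pow_ne_zero 2 (hk0 w hw)
  have hkn : ∀ w ∈ Metric.ball (0 : ℂ) R, 1 ≤ ‖k w‖ := fun w hw =>
    (hk1 w hw).trans (Complex.re_le_norm _)
  refine ⟨E, ⟨hED.mono hsub, ?_, ?_, ?_⟩, ?_⟩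
  · intro w hw
    simp only [hE, Complex.inv_re]
    refine div_nonneg ?_ (Complex.normSq_nonneg _)
    rw [pow_two, Complex.mul_re]
    have := sq_le_sq' (neg_le_of_abs_le (hks w (hsub hw))) (le_of_abs_le (hks w (hsub hw)))
    nlinarith
  · intro w hw
    simp only [hE, norm_inv, norm_pow]
    exact inv_le_one_of_one_le₀ (one_le_pow₀ (hkn w (hsub hw)))
  · have h1 : k 0 = ((1 + ∑ j, Real.sqrt (η j * (1 + ∑ i, c j i)) : ℝ) : ℂ) := by
      simp [hk, hψ0]
    have h2 : ∑ j, Real.sqrt (η j * (1 + ∑ i, c j i)) ≤ 1 := by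
      refine (Finset.sum_le_sum fun j _ => ?_).trans hv1
      exact (Real.sqrt_le_sqrt (hxv j)).trans (Real.sqrt_sq (hv j).le).le
    have h3 : 0 ≤ ∑ j, Real.sqrt (η j * (1 + ∑ i, c j i)) :=
      Finset.sum_nonneg fun j _ => Real.sqrt_nonneg _
    simp only [hE]
    rw [h1, ← Complex.ofReal_pow, ← Complex.ofReal_inv, Complex.ofReal_re, one_div]
    refine inv_anti₀ (by positivity) ?_
    nlinarith
  · have hmain : ∀ j, ∑ i, c j i *
        (∫ s in (0 : ℝ)..1, (z i * s) * (E (z i * s) * Q j (z i * s))).re ≤ v j / 2 := by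
      intro j
      have hEQ : DifferentiableOn ℂ (fun w => E w * Q j w) (Metric.ball 0 R) :=
        hED.mul (hQ j).differentiableOn
      have hder : ∀ w ∈ Metric.ball (0 : ℂ) R, deriv (φ j) w =
          η j * ∑ i, c j i * (conj (z i) / (1 - conj (z i) * w) ^ 2) := fun w hw =>
        (hφd j w hw).deriv
      have h1φ : ∀ w ∈ Metric.ball (0 : ℂ) R, 1 + φ j w ≠ 0 := fun w hw h => by
        have h1 := congrArg Complex.re h
        have h2 := hφre j w hw
        simp at h1; linarith
      have hcont : ContinuousOn (fun w => deriv (φ j) w / (1 + φ j w)) (Metric.ball 0 R) :=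
        ((hφD j).deriv Metric.isOpen_ball).continuousOn.div
          ((hφD j).continuousOn.const_add 1) h1φ
      have hwt : Continuous fun w : ℂ => 1 - ‖w‖ ^ 2 := by fun_prop
      have hpair := norm_integral_pairing_le (E := E) (Q := Q j) (H := deriv (φ j))
        (D := fun w => deriv (φ j) w / (1 + φ j w)) (q := v j ^ 4 / 20)
        (by have := hv j; positivity) (fun w hw => by
          have hw' := hsub hw
          have hφn : ‖φ j w‖ = (ψ j w).re ^ 2 + (ψ j w).im ^ 2 := by
            rw [← (hψs j w hw').1, norm_pow, ← Complex.normSq_eq_norm_sq, Complex.normSq_apply]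
            ring
          have him : (ψ j w).im ^ 2 ≤ (ψ j w).re ^ 2 := sq_le_sq'
            (neg_le_of_abs_le (hψs j w hw').2) (le_of_abs_le (hψs j w hw').2)
          have h1 : ‖1 + φ j w‖ ≤ 2 * ‖k w‖ ^ 2 := by
            have h2 := (hkψ j w hw').trans (Complex.re_le_norm (k w))
            have h3 := hψre j w hw'
            have h4 : (1 + (ψ j w).re) ^ 2 ≤ ‖k w‖ ^ 2 := by gcongr
            have h5 := norm_add_le 1 (φ j w)
            rw [norm_one] at h5
            nlinarith
          have h2 : 0 < ‖1 + φ j w‖ := norm_pos_iff.2 (h1φ w hw')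
          have h3 : 0 < ‖k w‖ := norm_pos_iff.2 (hk0 w hw')
          simp only [hE, norm_inv, norm_pow, norm_div]
          rw [← mul_div_assoc, le_div_iff₀ h2, inv_mul_eq_div, div_mul_eq_mul_div,
            div_le_iff₀ (by positivity)]
          nlinarith [norm_nonneg (deriv (φ j) w)])
        (integrableOn_ball_of_continuousOn hR ((hcont.norm.pow 2).mul hwt.continuousOn))
        (integrableOn_ball_of_continuousOn hR
          (((hQ j).continuous.norm.pow 2).mul hwt).continuousOn)
        (integral_log_deriv_sq_le hR (hφD j) (hφre j) (hφ0 j) (hx0 j) (hx1 j)) (hQn j)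
      have hint : ∫ w in Metric.ball (0 : ℂ) 1, (E w * Q j w) * conj (deriv (φ j) w) *
          ((1 - ‖w‖ ^ 2 : ℝ) : ℂ) = η j * ∑ i, c j i * (Real.pi *
            ∫ s in (0 : ℝ)..1, (z i * s) * (E (z i * s) * Q j (z i * s))) := by
        have hi : ∀ i, IntegrableOn (fun w => (E w * Q j w) *
            conj (conj (z i) / (1 - conj (z i) * w) ^ 2) * ((1 - ‖w‖ ^ 2 : ℝ) : ℂ))
            (Metric.ball (0 : ℂ) 1) := by
          intro i
          refine integrableOn_ball_of_continuousOn hR ((hEQ.continuousOn.mul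
            (Complex.continuous_conj.comp_continuousOn ?_)).mul
            (Complex.continuous_ofReal.comp hwt).continuousOn)
          exact ContinuousOn.div continuousOn_const (by fun_prop)
            fun w hw => pow_ne_zero 2 (hden0 i w hw)
        calc _ = ∫ w in Metric.ball (0 : ℂ) 1, ∑ i, (η j * c j i : ℂ) * ((E w * Q j w) *
            conj (conj (z i) / (1 - conj (z i) * w) ^ 2) * ((1 - ‖w‖ ^ 2 : ℝ) : ℂ)) := by
              refine setIntegral_congr_fun Metric.isOpen_ball.measurableSet fun w hw => ?_
              simp only [hder w (hsub hw), map_mul, map_sum, Complex.conj_ofReal, Finset.mul_sum,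
                Finset.sum_mul]
              exact Finset.sum_congr rfl fun i _ => by ring
          _ = ∑ i, (η j * c j i : ℂ) * ∫ w in Metric.ball (0 : ℂ) 1, ((E w * Q j w) *
            conj (conj (z i) / (1 - conj (z i) * w) ^ 2) * ((1 - ‖w‖ ^ 2 : ℝ) : ℂ)) := by
              rw [integral_finsetSum _ fun i _ => (hi i).const_mul _]
              simp_rw [integral_const_mul]
          _ = _ := by
              rw [Finset.mul_sum]
              refine Finset.sum_congr rfl fun i _ => ?_
              rw [integral_ball_mul_conj_kernel hR hEQ (hz i)]
              ring
      rw [hint] at hpair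
      have hre := (Complex.re_le_norm _).trans hpair
      rw [Complex.re_ofReal_mul, Complex.re_sum] at hre
      simp only [Complex.re_ofReal_mul] at hre
      have e : ∑ i, c j i * (Real.pi *
          (∫ s in (0 : ℝ)..1, (z i * s) * (E (z i * s) * Q j (z i * s))).re) =
          Real.pi * ∑ i, c j i *
          (∫ s in (0 : ℝ)..1, (z i * s) * (E (z i * s) * Q j (z i * s))).re := by
        rw [Finset.mul_sum]
        exact Finset.sum_congr rfl fun i _ => by ring
      rw [e] at hre
      set S := ∑ i, c j i * (∫ s in (0 : ℝ)..1, (z i * s) * (E (z i * s) * Q j (z i * s))).re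
      have h3 := Real.pi_gt_three
      have hvj := hv j
      have hv3 : 0 < v j ^ 3 := by positivity
      simp only [hη] at hre
      by_contra! hS
      have hS0 : 0 < S := by linarith
      have : 3 * (v j / 2) < Real.pi * S := by nlinarith
      have : v j ^ 3 / 2 * (3 * (v j / 2)) < v j ^ 3 / 2 * (Real.pi * S) := by gcongr
      have hv4 : 0 < v j ^ 4 := by positivity
      nlinarith
    have := Finset.sum_le_sum fun j (_ : j ∈ Finset.univ) => hmain j
    rw [← Finset.sum_div] at this
    linarith

theorem exists_mem_forall_lt_of_forall_sum_lt {ι : Type*} [Fintype ι] {S : Set (ι → ℝ)}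
    (hS : Convex ℝ S) (hne : S.Nonempty) {δ : ι → ℝ} (hδ : ∀ i, 0 < δ i)
    (h : ∀ c : ι → ℝ, (∀ i, 0 ≤ c i) → ∑ i, c i * δ i = 1 → ∃ x ∈ S, ∑ i, c i * x i < 1) :
    ∃ x ∈ S, ∀ i, x i < δ i := by
  classical
  by_contra! hcon
  set O : Set (ι → ℝ) := Set.pi univ fun i => Set.Iio (δ i) with hO
  have hOo : IsOpen O := isOpen_set_pi finite_univ fun i _ => isOpen_Iio
  have hOc : Convex ℝ O := convex_pi fun i _ => convex_Iio _
  have hdisj : Disjoint O S := by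
    rw [Set.disjoint_left]
    intro x hx hxS
    obtain ⟨i, hi⟩ := hcon x hxS
    exact absurd (hx i (mem_univ i)) (not_lt.2 hi)
  obtain ⟨f, u, hf1, hf2⟩ := geometric_hahn_banach_open hOc hOo hS hdisj
  set c : ι → ℝ := fun i => f (Pi.single i 1) with hc
  have hfx : ∀ x : ι → ℝ, f x = ∑ i, c i * x i := by
    intro x
    conv_lhs => rw [pi_eq_sum_univ' x, map_sum]
    refine Finset.sum_congr rfl fun i _ => ?_
    rw [map_smul, smul_eq_mul, mul_comm]
  have h0 : (0 : ι → ℝ) ∈ O := fun i _ => hδ i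
  have hu : 0 < u := by simpa using hf1 0 h0
  have hc0 : ∀ i, 0 ≤ c i := by
    intro i
    by_contra! hi
    have hmem : (u / c i) • (Pi.single i 1 : ι → ℝ) ∈ O := by
      intro j _
      have hneg : u / c i < 0 := div_neg_of_pos_of_neg hu hi
      by_cases hj : j = i
      · subst hj; simpa using hneg.trans (hδ j)
      · simpa [Pi.single_apply, hj] using hδ j
    have := hf1 _ hmem
    rw [map_smul, smul_eq_mul] at this
    change u / c i * c i < u at this
    rw [div_mul_cancel₀ _ hi.ne] at this
    exact lt_irrefl _ this
  have hle : ∑ i, c i * δ i ≤ u := by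
    rw [← hfx]
    have hcl : δ ∈ closure O := by
      rw [hO, closure_pi_set]
      intro i _
      simp
    exact closure_minimal (fun x hx => (hf1 x hx).le)
      (isClosed_le f.continuous continuous_const) hcl
  obtain ⟨x₀, hx₀⟩ := hne
  have hpos : 0 < ∑ i, c i * δ i := by
    by_contra! hz
    have hz' := fun i => (Finset.sum_eq_zero_iff_of_nonneg
      fun i _ => mul_nonneg (hc0 i) (hδ i).le).1 (le_antisymm hz
        (Finset.sum_nonneg fun i _ => mul_nonneg (hc0 i) (hδ i).le)) i (Finset.mem_univ i)
    have hci : ∀ i, c i = 0 := fun i => (mul_eq_zero.1 (hz' i)).resolve_right (hδ i).ne'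
    have := hf2 x₀ hx₀
    rw [hfx] at this
    simp only [hci, zero_mul, Finset.sum_const_zero] at this
    linarith
  set D := ∑ i, c i * δ i
  obtain ⟨x, hxS, hx⟩ := h (fun i => c i / D) (fun i => div_nonneg (hc0 i) hpos.le) (by
    simp_rw [div_mul_eq_mul_div]
    rw [← Finset.sum_div, div_self hpos.ne'])
  simp_rw [div_mul_eq_mul_div] at hx
  rw [← Finset.sum_div, div_lt_one hpos, ← hfx] at hx
  linarith [hf2 x hxS]

/-- The pairing of analytic functions with the Cauchy kernel of the primitive. -/
def segmentIntegral (z : ℂ) (Φ : ℂ → ℂ) : ℂ := ∫ s in (0 : ℝ)..1, (z * s) * Φ (z * s)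

theorem mul_ofReal_mem_ball {z : ℂ} (hz : ‖z‖ < 1) {s : ℝ} (hs : s ∈ Set.uIcc (0 : ℝ) 1) :
    z * s ∈ Metric.ball (0 : ℂ) 1 := by
  rw [Set.uIcc_of_le zero_le_one] at hs
  rw [mem_ball_zero_iff, norm_mul, Complex.norm_real, Real.norm_eq_abs, abs_of_nonneg hs.1]
  exact mul_lt_one_of_nonneg_of_lt_one_left (norm_nonneg _) hz hs.2

theorem ContinuousOn.comp_segment {Φ : ℂ → ℂ} (h : ContinuousOn Φ (Metric.ball 0 1)) {z : ℂ}
    (hz : ‖z‖ < 1) : ContinuousOn (fun s : ℝ => Φ (z * s)) (Set.uIcc 0 1) :=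
  h.comp (by fun_prop) fun _ hs => mul_ofReal_mem_ball hz hs

theorem intervalIntegrable_segment {Φ : ℂ → ℂ} (h : ContinuousOn Φ (Metric.ball 0 1)) {z : ℂ}
    (hz : ‖z‖ < 1) : IntervalIntegrable (fun s : ℝ => (z * s) * Φ (z * s)) volume 0 1 :=
  ContinuousOn.intervalIntegrable
    (ContinuousOn.mul (by fun_prop) (h.comp_segment hz))

theorem convex_setOf_isMultiplier : Convex ℝ {E | IsMultiplier E} := by
  rintro E ⟨h1, h2, h3, h4⟩ E' ⟨h1', h2', h3', h4'⟩ a b ha hb hab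
  refine ⟨(h1.const_smul a).add (h1'.const_smul b), fun w hw => ?_, fun w hw => ?_, ?_⟩
  · have := h2 w hw
    have := h2' w hw
    simp only [Pi.add_apply, Pi.smul_apply, Complex.add_re, Complex.smul_re, smul_eq_mul]
    positivity
  · simp only [Pi.add_apply, Pi.smul_apply]
    refine (norm_add_le _ _).trans ?_
    rw [norm_smul, norm_smul, Real.norm_of_nonneg ha, Real.norm_of_nonneg hb]
    nlinarith [h3 w hw, h3' w hw]
  · simp only [Pi.add_apply, Pi.smul_apply, Complex.add_re, Complex.smul_re, smul_eq_mul]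
    nlinarith

theorem isMultiplier_one : IsMultiplier fun _ => 1 :=
  ⟨differentiableOn_const _, by simp, by simp, by norm_num⟩

theorem exists_isMultiplier_forall_mem_finset {J : Type*} {v : J → ℝ}
    (hv : ∀ j, 0 < v j) (hv1 : ∀ u : Finset J, ∑ j ∈ u, v j ≤ 1) {Q : J → ℂ → ℂ}
    (hQ : ∀ j, Differentiable ℂ (Q j))
    (hQn : ∀ j, ∫ w in Metric.ball (0 : ℂ) 1, ‖Q j w‖ ^ 2 * (1 - ‖w‖ ^ 2) ≤ (v j ^ 4 / 20) ^ 2)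
    (u : Finset (J × Metric.ball (0 : ℂ) 1)) :
    ∃ E : ℂ → ℂ, IsMultiplier E ∧
      ∀ p ∈ u, (segmentIntegral p.2 fun w => E w * Q p.1 w).re ≤ v p.1 := by
  classical
  set A := u.image Prod.fst
  set Z := u.image Prod.snd
  set S : Set (A × Z → ℝ) := {x | ∃ E : ℂ → ℂ, IsMultiplier E ∧
    ∀ p, x p = (segmentIntegral (p.2 : Metric.ball (0 : ℂ) 1) fun w => E w * Q p.1 w).re} with hS
  have hz : ∀ z : Metric.ball (0 : ℂ) 1, ‖(z : ℂ)‖ < 1 := fun z => mem_ball_zero_iff.1 z.2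
  have hconv : Convex ℝ S := by
    rintro x ⟨E, hE, hx⟩ y ⟨E', hE', hy⟩ a b ha hb hab
    refine ⟨a • E + b • E', convex_setOf_isMultiplier hE hE' ha hb hab, fun p => ?_⟩
    have i1 := intervalIntegrable_segment (Φ := fun w => E w * Q p.1 w)
      (z := (p.2 : Metric.ball (0 : ℂ) 1)) (hE.1.continuousOn.mul (hQ p.1).continuous.continuousOn) (hz _)
    have i2 := intervalIntegrable_segment (Φ := fun w => E' w * Q p.1 w)
      (z := (p.2 : Metric.ball (0 : ℂ) 1)) (hE'.1.continuousOn.mul (hQ p.1).continuous.continuousOn) (hz _)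
    have e : (segmentIntegral (p.2 : Metric.ball (0 : ℂ) 1)
        fun w => (a • E + b • E') w * Q p.1 w) =
        a • (segmentIntegral (p.2 : Metric.ball (0 : ℂ) 1) fun w => E w * Q p.1 w) +
        b • (segmentIntegral (p.2 : Metric.ball (0 : ℂ) 1) fun w => E' w * Q p.1 w) := by
      simp only [segmentIntegral]
      rw [← intervalIntegral.integral_smul, ← intervalIntegral.integral_smul,
        ← intervalIntegral.integral_add]
      rotate_left
      · exact i1.smul a
      · exact i2.smul b
      refine intervalIntegral.integral_congr fun s _ => ?_
      simp only [Pi.add_apply, Pi.smul_apply, Complex.real_smul]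
      ring
    rw [e]
    simp only [Pi.add_apply, Pi.smul_apply, hx p, hy p, Complex.add_re, Complex.smul_re,
      smul_eq_mul]
  have hne : S.Nonempty := ⟨_, _, isMultiplier_one, fun p => rfl⟩
  obtain ⟨x, ⟨E, hE, hx⟩, hxv⟩ := exists_mem_forall_lt_of_forall_sum_lt hconv hne
    (δ := fun p => v p.1) (fun p => hv _) (fun c hc hcv => by
      obtain ⟨E, hE, hlt⟩ := exists_isMultiplier_sum_lt (J := A) (ι := Z) (v := fun j => v j)
        (fun j => hv j) (by rw [Finset.sum_coe_sort A v]; exact hv1 A) (Q := fun j => Q j)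
        (fun j => hQ j) (fun j => hQn j) (z := fun i => ((i : Metric.ball (0 : ℂ) 1) : ℂ))
        (fun i => hz _) (c := fun j i => c (j, i)) (fun j i => hc _)
        (by simpa only [Fintype.sum_prod_type] using hcv)
      refine ⟨_, ⟨E, hE, fun p => rfl⟩, ?_⟩
      rw [Fintype.sum_prod_type]
      exact hlt)
  refine ⟨E, hE, fun p hp => ?_⟩
  have h1 : p.1 ∈ A := Finset.mem_image_of_mem _ hp
  have h2 : p.2 ∈ Z := Finset.mem_image_of_mem _ hp
  have := hxv (⟨p.1, h1⟩, ⟨p.2, h2⟩)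
  rw [hx] at this
  exact this.le

theorem norm_taylorCoeff_le_one {E : ℂ → ℂ} (hE : DifferentiableOn ℂ E (Metric.ball 0 1))
    (h1 : ∀ w ∈ Metric.ball (0 : ℂ) 1, ‖E w‖ ≤ 1) (k : ℕ) : ‖taylorCoeff E k‖ ≤ 1 := by
  have hr : ∀ r ∈ Set.Ioo (0 : ℝ) 1, ‖taylorCoeff E k‖ * r ^ k ≤ 1 := by
    intro r hr
    have hsub : Metric.closedBall (0 : ℂ) r ⊆ Metric.ball 0 1 :=
      Metric.closedBall_subset_ball hr.2
    have hd : DiffContOnCl ℂ E (Metric.ball 0 r) := by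
      refine DifferentiableOn.diffContOnCl ?_
      rw [closure_ball _ hr.1.ne']
      exact hE.mono hsub
    have h2 := Complex.norm_iteratedDeriv_le_of_forall_mem_sphere_norm_le k hr.1 hd
      (fun z hz => h1 z (hsub (Metric.sphere_subset_closedBall hz)))
    have hk : (0 : ℝ) < k.factorial := by exact_mod_cast k.factorial_pos
    have hrk : 0 < r ^ k := pow_pos hr.1 k
    rw [taylorCoeff, norm_mul, norm_inv, Complex.norm_natCast, inv_mul_eq_div,
      div_mul_eq_mul_div, div_le_one hk]
    rw [mul_one, le_div_iff₀ hrk] at h2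
    exact h2
  have ht : Tendsto (fun r : ℝ => ‖taylorCoeff E k‖ * r ^ k) (𝓝[<] 1)
      (𝓝 (‖taylorCoeff E k‖ * 1 ^ k)) :=
    Tendsto.mono_left (Continuous.tendsto (by fun_prop) 1) nhdsWithin_le_nhds
  have := le_of_tendsto ht (b := 1)
    (by filter_upwards [Ioo_mem_nhdsLT (zero_lt_one (α := ℝ))] with r h using hr r h)
  simpa using this

/-- The power series with coefficients in the closed unit disc. -/
def unitSeries (a : ℕ → Metric.closedBall (0 : ℂ) 1) (w : ℂ) : ℂ := ∑' k, (a k : ℂ) * w ^ k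

theorem norm_unitSeries_term_le (a : ℕ → Metric.closedBall (0 : ℂ) 1) (w : ℂ) {r : ℝ}
    (hw : ‖w‖ ≤ r) (k : ℕ) : ‖(a k : ℂ) * w ^ k‖ ≤ r ^ k := by
  rw [norm_mul, norm_pow]
  have h1 : ‖(a k : ℂ)‖ ≤ 1 := mem_closedBall_zero_iff.1 (a k).2
  have h2 : ‖w‖ ^ k ≤ r ^ k := by gcongr
  exact (mul_le_of_le_one_left (by positivity) h1).trans h2

theorem differentiableOn_unitSeries (a : ℕ → Metric.closedBall (0 : ℂ) 1) :
    DifferentiableOn ℂ (unitSeries a) (Metric.ball 0 1) := by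
  intro w hw
  have hw1 : ‖w‖ < 1 := mem_ball_zero_iff.1 hw
  obtain ⟨r, hwr, hr1⟩ := exists_between hw1
  have hr0 : 0 ≤ r := (norm_nonneg _).trans hwr.le
  have h := Complex.differentiableOn_tsum_of_summable_norm (U := Metric.ball (0 : ℂ) r)
    (F := fun k w => (a k : ℂ) * w ^ k) (summable_geometric_of_lt_one hr0 hr1)
    (fun k => by fun_prop) Metric.isOpen_ball
    (fun k w hw => norm_unitSeries_term_le a w (mem_ball_zero_iff.1 hw).le k)
  exact (h.differentiableAt (Metric.isOpen_ball.mem_nhds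
    (mem_ball_zero_iff.2 hwr))).differentiableWithinAt

theorem continuous_unitSeries_apply {w : ℂ} (hw : ‖w‖ < 1) :
    Continuous fun a : ℕ → Metric.closedBall (0 : ℂ) 1 => unitSeries a w :=
  continuous_tsum (fun k => by fun_prop) (summable_geometric_of_lt_one (norm_nonneg w) hw)
    fun k a => norm_unitSeries_term_le a w le_rfl k

theorem norm_unitSeries_le (a : ℕ → Metric.closedBall (0 : ℂ) 1) {w : ℂ} {r : ℝ} (hw : ‖w‖ ≤ r)
    (hr : r < 1) : ‖unitSeries a w‖ ≤ (1 - r)⁻¹ :=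
  tsum_of_norm_bounded (hasSum_geometric_of_lt_one ((norm_nonneg _).trans hw) hr)
    fun k => norm_unitSeries_term_le a w hw k

theorem continuous_segmentIntegral_unitSeries {z : ℂ} (hz : ‖z‖ < 1) {Q : ℂ → ℂ}
    (hQ : Continuous Q) : Continuous fun a : ℕ → Metric.closedBall (0 : ℂ) 1 =>
      segmentIntegral z fun w => unitSeries a w * Q w := by
  have hzs : ∀ s ∈ Set.uIcc (0 : ℝ) 1, ‖z * s‖ ≤ ‖z‖ := by
    intro s hs
    rw [Set.uIcc_of_le zero_le_one] at hs
    rw [norm_mul, Complex.norm_real, Real.norm_eq_abs, abs_of_nonneg hs.1]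
    exact mul_le_of_le_one_right (norm_nonneg _) hs.2
  refine intervalIntegral.continuous_of_dominated_interval
    (bound := fun s => ‖z * s‖ * ((1 - ‖z‖)⁻¹ * ‖Q (z * s)‖)) ?_ ?_ ?_ ?_
  · intro a
    rw [Set.uIoc_of_le zero_le_one]
    exact ((intervalIntegrable_segment (Φ := fun w => unitSeries a w * Q w)
      ((differentiableOn_unitSeries a).continuousOn.mul hQ.continuousOn) hz).aestronglyMeasurable)
  · refine fun a => ae_of_all _ fun s hs => ?_
    rw [norm_mul, norm_mul (unitSeries a _)]
    gcongr
    exact norm_unitSeries_le a (hzs s (Set.uIoc_subset_uIcc hs)) hz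
  · exact Continuous.intervalIntegrable (by fun_prop) _ _
  · refine ae_of_all _ fun s hs => ?_
    exact ((continuous_unitSeries_apply ((hzs s (Set.uIoc_subset_uIcc hs)).trans_lt hz)).mul
      continuous_const).const_mul _

theorem exists_isMultiplier_forall_le {J : Type*} {v : J → ℝ}
    (hv : ∀ j, 0 < v j) (hv1 : ∀ u : Finset J, ∑ j ∈ u, v j ≤ 1) {Q : J → ℂ → ℂ}
    (hQ : ∀ j, Differentiable ℂ (Q j))
    (hQn : ∀ j, ∫ w in Metric.ball (0 : ℂ) 1, ‖Q j w‖ ^ 2 * (1 - ‖w‖ ^ 2) ≤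
      (v j ^ 4 / 20) ^ 2) :
    ∃ E : ℂ → ℂ, IsMultiplier E ∧
      ∀ j z, ‖z‖ < 1 → (segmentIntegral z fun w => E w * Q j w).re ≤ v j := by
  set X := ℕ → Metric.closedBall (0 : ℂ) 1
  have : CompactSpace (Metric.closedBall (0 : ℂ) 1) :=
    isCompact_iff_compactSpace.1 (isCompact_closedBall _ _)
  have hz : ∀ z : Metric.ball (0 : ℂ) 1, ‖(z : ℂ)‖ < 1 := fun z => mem_ball_zero_iff.1 z.2
  set K : Set X := (⋂ w : Metric.ball (0 : ℂ) 1, {a | 0 ≤ (unitSeries a w).re}) ∩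
    ((⋂ w : Metric.ball (0 : ℂ) 1, {a | ‖unitSeries a w‖ ≤ 1}) ∩
      {a | 1 / 4 ≤ (unitSeries a 0).re}) with hK
  have hKc : IsClosed K := by
    refine IsClosed.inter ?_ (IsClosed.inter ?_ ?_)
    · exact isClosed_iInter fun w => isClosed_le continuous_const
        (Complex.continuous_re.comp (continuous_unitSeries_apply (hz w)))
    · exact isClosed_iInter fun w => isClosed_le (continuous_unitSeries_apply (hz w)).norm
        continuous_const
    · exact isClosed_le continuous_const
        (Complex.continuous_re.comp (continuous_unitSeries_apply (by simp)))
  obtain ⟨a, haK, ha⟩ := hKc.isCompact.inter_iInter_nonempty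
    (fun p : J × Metric.ball (0 : ℂ) 1 =>
      {a : X | (segmentIntegral p.2 fun w => unitSeries a w * Q p.1 w).re ≤ v p.1})
    (fun p => isClosed_le (Complex.continuous_re.comp
      (continuous_segmentIntegral_unitSeries (hz p.2) (hQ p.1).continuous)) continuous_const)
    (fun u => by
      obtain ⟨E, ⟨h1, h2, h3, h4⟩, h5⟩ := exists_isMultiplier_forall_mem_finset hv hv1 hQ hQn u
      let a : X := fun k => ⟨taylorCoeff E k, by
        simpa using norm_taylorCoeff_le_one h1 h3 k⟩
      have hae : ∀ w, ‖w‖ < 1 → unitSeries a w = E w := fun w hw =>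
        (hasSum_taylorCoeff h1 hw).tsum_eq
      refine ⟨a, ⟨Set.mem_iInter.2 fun w => ?_, Set.mem_iInter.2 fun w => ?_, ?_⟩, ?_⟩
      · rw [Set.mem_ofPred_eq, hae w (hz w)]; exact h2 w w.2
      · rw [Set.mem_ofPred_eq, hae w (hz w)]; exact h3 w w.2
      · rw [Set.mem_ofPred_eq, hae 0 (by simp)]; exact h4
      · simp only [Set.mem_iInter]
        intro p hp
        have e : (segmentIntegral p.2 fun w => unitSeries a w * Q p.1 w) =
            segmentIntegral p.2 fun w => E w * Q p.1 w := by
          refine intervalIntegral.integral_congr fun s hs => ?_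
          simp only [hae _ (mem_ball_zero_iff.1 (mul_ofReal_mem_ball (hz p.2) hs))]
        rw [Set.mem_ofPred_eq, e]
        exact h5 p hp)
  refine ⟨unitSeries a, ⟨differentiableOn_unitSeries a, fun w hw => Set.mem_iInter.1 haK.1 ⟨w, hw⟩,
    fun w hw => Set.mem_iInter.1 haK.2.1 ⟨w, hw⟩, haK.2.2⟩, fun j z hz => ?_⟩
  exact Set.mem_iInter.1 ha (j, ⟨z, mem_ball_zero_iff.2 hz⟩)

theorem hasSum_integral_ball_norm_sq {a : ℕ → ℂ} (ha : Summable fun k => ‖a k‖) {Φ : ℂ → ℂ}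
    (hΦ : ∀ w ∈ Metric.ball (0 : ℂ) 1, HasSum (fun k => a k * w ^ k) (Φ w)) :
    HasSum (fun k : ℕ => ‖a k‖ ^ 2 * (Real.pi / ((k + 1) * (k + 2))))
      (∫ w in Metric.ball (0 : ℂ) 1, ‖Φ w‖ ^ 2 * (1 - ‖w‖ ^ 2)) := by
  have h := hasSum_integral_ball_mul_conj_weight ha ha
  rw [← Complex.hasSum_ofReal]
  have e1 : (fun k : ℕ => ((‖a k‖ ^ 2 * (Real.pi / ((k + 1) * (k + 2))) : ℝ) : ℂ)) =
      fun k : ℕ => a k * conj (a k) * ((Real.pi / ((k + 1) * (k + 2)) : ℝ) : ℂ) := by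
    ext k
    rw [Complex.mul_conj, Complex.normSq_eq_norm_sq, Complex.ofReal_mul]
  have e2 : ((∫ w in Metric.ball (0 : ℂ) 1, ‖Φ w‖ ^ 2 * (1 - ‖w‖ ^ 2) : ℝ) : ℂ) =
      ∫ w in Metric.ball (0 : ℂ) 1,
        (∑' k, a k * w ^ k) * conj (∑' k, a k * w ^ k) * ((1 - ‖w‖ ^ 2 : ℝ) : ℂ) := by
    rw [← integral_complex_ofReal]
    refine setIntegral_congr_fun Metric.isOpen_ball.measurableSet fun w hw => ?_
    simp only [(hΦ w hw).tsum_eq]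
    rw [Complex.mul_conj, Complex.normSq_eq_norm_sq, Complex.ofReal_mul]
  rw [e1, e2]
  exact h

theorem unitDisc_eq_ball : unitDisc = Metric.ball (0 : ℂ) 1 := by
  ext z; simp [unitDisc]

theorem summable_taylorCoeff_of_memA21 {F : ℂ → ℂ} (hF : MemA21 F) :
    Summable fun k : ℕ => ‖taylorCoeff F k‖ ^ 2 / ((k + 1) * (k + 2)) := by
  obtain ⟨hFd, hFi⟩ := hF
  rw [unitDisc_eq_ball] at hFd hFi
  set C := ∫ w in Metric.ball (0 : ℂ) 1, ‖F w‖ ^ 2 * (1 - ‖w‖ ^ 2) with hC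
  have hnn : ∀ w ∈ Metric.ball (0 : ℂ) 1, 0 ≤ ‖F w‖ ^ 2 * (1 - ‖w‖ ^ 2) := by
    intro w hw
    have hw1 : ‖w‖ < 1 := mem_ball_zero_iff.1 hw
    exact mul_nonneg (by positivity) (by nlinarith [norm_nonneg w])
  have hρ : ∀ ρ ∈ Set.Ioo (1 / 2 : ℝ) 1, ∀ M : ℕ, ∑ k ∈ Finset.range M,
      ‖taylorCoeff F k‖ ^ 2 * ρ ^ (2 * k) * (Real.pi / ((k + 1) * (k + 2))) ≤ 4 * C := by
    intro ρ hρ M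
    have hρ0 : 0 < ρ := by linarith [hρ.1]
    have hn : ∀ w ∈ Metric.ball (0 : ℂ) 1, ‖(ρ : ℂ) * w‖ < 1 := by
      intro w hw
      rw [norm_mul, Complex.norm_real, Real.norm_of_nonneg hρ0.le]
      exact mul_lt_one_of_nonneg_of_lt_one_left hρ0.le hρ.2 (mem_ball_zero_iff.1 hw).le
    have hs : Summable fun k => ‖taylorCoeff F k * (ρ : ℂ) ^ k‖ :=
      (hasSum_taylorCoeff hFd (w := ρ) (by simpa [abs_of_pos hρ0] using hρ.2)).summable.norm
    have h := hasSum_integral_ball_norm_sq (Φ := fun w => F (ρ * w)) hs (fun w hw => by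
      have := hasSum_taylorCoeff hFd (hn w hw)
      simpa only [mul_pow, mul_assoc] using this)
    have h1 := sum_le_hasSum (Finset.range M) (fun k _ => by positivity) h
    have h2 : ∑ k ∈ Finset.range M,
      ‖taylorCoeff F k‖ ^ 2 * ρ ^ (2 * k) * (Real.pi / ((k + 1) * (k + 2))) =
      ∑ k ∈ Finset.range M,
        ‖taylorCoeff F k * (ρ : ℂ) ^ k‖ ^ 2 * (Real.pi / ((k + 1) * (k + 2))) := by
      refine Finset.sum_congr rfl fun k _ => ?_
      rw [norm_mul, mul_pow, norm_pow, Complex.norm_real, Real.norm_of_nonneg hρ0.le, ← pow_mul,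
        mul_comm k 2]
    rw [h2]
    refine h1.trans ?_
    have hsm : ρ • Metric.ball (0 : ℂ) 1 ⊆ Metric.ball (0 : ℂ) 1 := by
      rintro _ ⟨w, hw, rfl⟩
      simpa using hn w hw
    have h3 := Measure.setIntegral_comp_smul_of_pos (volume : Measure ℂ)
      (fun w => ‖F w‖ ^ 2 * (1 - ‖w‖ ^ 2)) (Metric.ball (0 : ℂ) 1) hρ0
    have h4 : ∫ w in ρ • Metric.ball (0 : ℂ) 1, ‖F w‖ ^ 2 * (1 - ‖w‖ ^ 2) ≤ C :=
      setIntegral_mono_set hFi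
        ((ae_restrict_iff' Metric.isOpen_ball.measurableSet).2 (ae_of_all _ hnn))
        hsm.eventuallyLE
    have hC0 : 0 ≤ C := setIntegral_nonneg Metric.isOpen_ball.measurableSet hnn
    calc ∫ w in Metric.ball (0 : ℂ) 1, ‖F (ρ * w)‖ ^ 2 * (1 - ‖w‖ ^ 2)
        ≤ ∫ w in Metric.ball (0 : ℂ) 1, ‖F (ρ • w)‖ ^ 2 * (1 - ‖ρ • w‖ ^ 2) := by
          have hcF : ContinuousOn (fun w : ℂ => F (ρ * w)) (Metric.ball 0 (1 / ρ)) :=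
            hFd.continuousOn.comp (by fun_prop) fun w hw => by
              rw [mem_ball_zero_iff] at hw ⊢
              rw [norm_mul, Complex.norm_real, Real.norm_of_nonneg hρ0.le]
              rwa [lt_div_iff₀' hρ0] at hw
          have hR : 1 < 1 / ρ := by rw [one_lt_div hρ0]; exact hρ.2
          refine setIntegral_mono_on
            (integrableOn_ball_of_continuousOn hR ((hcF.norm.pow 2).mul (by fun_prop))) ?_
            Metric.isOpen_ball.measurableSet ?_
          · simp only [Complex.real_smul]
            exact integrableOn_ball_of_continuousOn hR ((hcF.norm.pow 2).mul (by fun_prop))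
          · intro w hw
            rw [Complex.real_smul, norm_mul (ρ : ℂ) w, Complex.norm_real,
              Real.norm_of_nonneg hρ0.le]
            have : ρ * ‖w‖ ≤ ‖w‖ := mul_le_of_le_one_left (norm_nonneg _) hρ.2.le
            gcongr
      _ = (ρ ^ 2)⁻¹ * ∫ w in ρ • Metric.ball (0 : ℂ) 1, ‖F w‖ ^ 2 * (1 - ‖w‖ ^ 2) := by
          rw [h3, Complex.finrank_real_complex, smul_eq_mul]
      _ ≤ 4 * C := by
          have : (ρ ^ 2)⁻¹ ≤ 4 := by
            rw [inv_le_comm₀ (by positivity) (by norm_num)]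
            nlinarith [hρ.1]
          have h0 : 0 ≤ (ρ ^ 2)⁻¹ := by positivity
          nlinarith
  refine summable_of_sum_range_le (c := 4 * C / Real.pi) (fun k => by positivity) fun M => ?_
  have ht : Tendsto (fun ρ : ℝ => ∑ k ∈ Finset.range M,
      ‖taylorCoeff F k‖ ^ 2 * ρ ^ (2 * k) * (Real.pi / ((k + 1) * (k + 2)))) (𝓝[<] 1)
      (𝓝 (∑ k ∈ Finset.range M,
      ‖taylorCoeff F k‖ ^ 2 * 1 ^ (2 * k) * (Real.pi / ((k + 1) * (k + 2))))) :=
    Tendsto.mono_left (Continuous.tendsto (by fun_prop) 1) nhdsWithin_le_nhds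
  have h := le_of_tendsto ht (b := 4 * C)
    (by filter_upwards [Ioo_mem_nhdsLT (by norm_num : (1 / 2 : ℝ) < 1)] with r h using hρ r h M)
  rw [le_div_iff₀ Real.pi_pos, Finset.sum_mul]
  refine le_trans (le_of_eq (Finset.sum_congr rfl fun k _ => ?_)) h
  rw [one_pow]; ring

/-- A block of Taylor coefficients, with one power of the variable removed. -/
def taylorBlock (a : ℕ → ℂ) (M N : ℕ) (w : ℂ) : ℂ := ∑ k ∈ Finset.Ico M N, a (k + 1) * w ^ k

theorem differentiable_taylorBlock (a : ℕ → ℂ) (M N : ℕ) : Differentiable ℂ (taylorBlock a M N) := by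
  unfold taylorBlock; fun_prop

theorem integral_taylorBlock_le (a : ℕ → ℂ) (M N : ℕ) :
    ∫ w in Metric.ball (0 : ℂ) 1, ‖taylorBlock a M N w‖ ^ 2 * (1 - ‖w‖ ^ 2) ≤
      12 * ∑ k ∈ Finset.Ico M N, ‖a (k + 1)‖ ^ 2 / ((((k + 1 : ℕ) : ℝ) + 1) * ((k + 1 : ℕ) + 2)) := by
  set b : ℕ → ℂ := fun k => if k ∈ Finset.Ico M N then a (k + 1) else 0 with hb
  have hb0 : ∀ k ∉ Finset.Ico M N, b k = 0 := fun k hk => if_neg hk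
  have hs : Summable fun k => ‖b k‖ :=
    summable_of_ne_finset_zero (s := Finset.Ico M N) fun k hk => by rw [hb0 k hk, norm_zero]
  have h := hasSum_integral_ball_norm_sq (Φ := taylorBlock a M N) hs (fun w _ => by
    have : HasSum (fun k => b k * w ^ k) (∑ k ∈ Finset.Ico M N, b k * w ^ k) :=
      hasSum_sum_of_ne_finset_zero fun k hk => by rw [hb0 k hk, zero_mul]
    have e : ∑ k ∈ Finset.Ico M N, b k * w ^ k = taylorBlock a M N w :=
      Finset.sum_congr rfl fun k hk => by simp only [hb, if_pos hk]
    rwa [e] at this)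
  have h' : HasSum (fun k : ℕ => ‖b k‖ ^ 2 * (Real.pi / ((k + 1) * (k + 2)))) (∑ k ∈ Finset.Ico M N,
      ‖b k‖ ^ 2 * (Real.pi / ((k + 1) * (k + 2)))) :=
    hasSum_sum_of_ne_finset_zero fun k hk => by rw [hb0 k hk]; simp
  rw [h.unique h', Finset.mul_sum]
  refine Finset.sum_le_sum fun k hk => ?_
  simp only [hb, if_pos hk]
  rw [mul_div_assoc', mul_div_assoc', div_le_div_iff₀ (by positivity) (by positivity)]
  push_cast
  have hpi := Real.pi_lt_four
  have hk0 : (0 : ℝ) ≤ k := k.cast_nonneg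
  have h1 : Real.pi * (((k : ℝ) + 1 + 1) * (k + 1 + 2)) ≤ 12 * ((k + 1) * (k + 2)) := by
    have : Real.pi * (((k : ℝ) + 1 + 1) * (k + 1 + 2)) ≤ 4 * (((k : ℝ) + 1 + 1) * (k + 1 + 2)) := by
      gcongr
    nlinarith
  nlinarith [sq_nonneg ‖a (k + 1)‖]

theorem norm_le_two_mul_of_re_I_pow_mul_le {t : ℂ} {x : ℝ}
    (h : ∀ k : Fin 4, (Complex.I ^ (k : ℕ) * t).re ≤ x) : ‖t‖ ≤ 2 * x := by
  have h0 := h 0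
  have h1 := h 1
  have h2 := h 2
  have h3 := h 3
  simp [pow_succ] at h0 h1 h2 h3
  have hre : |t.re| ≤ x := abs_le.2 ⟨by linarith, h0⟩
  have him : |t.im| ≤ x := abs_le.2 ⟨by linarith, by linarith⟩
  linarith [Complex.norm_le_abs_re_add_abs_im t]

theorem exists_isMultiplier_norm_segmentIntegral_le {a : ℕ → ℂ}
    (ha : Summable fun k : ℕ => ‖a k‖ ^ 2 / ((k + 1) * (k + 2))) :
    ∃ (E : ℂ → ℂ) (N : ℕ → ℕ), IsMultiplier E ∧ StrictMono N ∧ ∀ n z, ‖z‖ < 1 →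
      ‖segmentIntegral z fun w => E w * taylorBlock a (N n) (N (n + 1)) w‖ ≤ (1 / 2) ^ n := by
  set t : ℕ → ℝ := fun k => ‖a (k + 1)‖ ^ 2 / ((((k + 1 : ℕ) : ℝ) + 1) * ((k + 1 : ℕ) + 2)) with ht
  have hts : Summable t := (summable_nat_add_iff 1).2 ha
  have ht0 : ∀ k, 0 ≤ t k := fun k => by positivity
  set x : ℕ → ℝ := fun n => (1 / 2) ^ (n + 3) with hx
  have hx0 : ∀ n, 0 < x n := fun n => by positivity
  obtain ⟨N, hN, hNt⟩ := Filter.extraction_forall_of_eventually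
    (P := fun n M => (∑' k, t k) - ∑ k ∈ Finset.range M, t k < (x n ^ 4 / 20) ^ 2 / 12) (fun n => by
      have h1 : Tendsto (fun M => (∑' k, t k) - ∑ k ∈ Finset.range M, t k) atTop (𝓝 0) := by
        have := hts.hasSum.tendsto_sum_nat.const_sub (∑' k, t k)
        rwa [sub_self] at this
      have := hx0 n
      exact h1.eventually_lt_const (by positivity))
  have hQn : ∀ n, ∫ w in Metric.ball (0 : ℂ) 1, ‖taylorBlock a (N n) (N (n + 1)) w‖ ^ 2 *
      (1 - ‖w‖ ^ 2) ≤ (x n ^ 4 / 20) ^ 2 := by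
    intro n
    refine (integral_taylorBlock_le a _ _).trans ?_
    have h1 := Finset.sum_range_add_sum_Ico t (hN.monotone n.le_succ)
    have h2 := hts.sum_le_tsum (Finset.range (N (n + 1))) fun k _ => ht0 k
    have h3 := hNt n
    simp only [ht] at h1 h2 h3 ⊢
    linarith
  obtain ⟨E, hE, hEQ⟩ := exists_isMultiplier_forall_le (J := ℕ × Fin 4) (v := fun p => x p.1)
    (fun p => hx0 p.1) (fun u => by
      obtain ⟨M, hM⟩ : ∃ M, u ⊆ Finset.range M ×ˢ Finset.univ := by
        obtain ⟨M, hM⟩ := (u.image Prod.fst).exists_nat_subset_range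
        exact ⟨M, fun p hp => Finset.mem_product.2
          ⟨hM (Finset.mem_image_of_mem _ hp), Finset.mem_univ _⟩⟩
      refine (Finset.sum_le_sum_of_subset_of_nonneg hM fun p _ _ => (hx0 p.1).le).trans ?_
      rw [Finset.sum_product]
      simp only [hx, Finset.sum_const, Finset.card_univ, Fintype.card_fin, pow_add, nsmul_eq_mul]
      rw [← Finset.mul_sum, ← Finset.sum_mul]
      have := sum_geometric_two_le M
      norm_num at this ⊢
      linarith)
    (Q := fun p w => Complex.I ^ (p.2 : ℕ) * taylorBlock a (N p.1) (N (p.1 + 1)) w)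
    (fun p => (differentiable_taylorBlock _ _ _).const_mul _)
    (fun p => by simpa using hQn p.1)
  refine ⟨E, N, hE, hN, fun n z hz => ?_⟩
  have h := norm_le_two_mul_of_re_I_pow_mul_le (x := x n)
    (t := segmentIntegral z fun w => E w * taylorBlock a (N n) (N (n + 1)) w) (fun k => by
      have := hEQ (n, k) z hz
      convert this using 2
      simp only [segmentIntegral]
      rw [← intervalIntegral.integral_const_mul]
      refine intervalIntegral.integral_congr fun s _ => ?_
      ring)
  refine h.trans ?_
  simp only [hx, pow_add]
  have : (0 : ℝ) < (1 / 2) ^ n := by positivity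
  linarith

theorem sub_eq_integral_of_hasDerivAt {G Φ : ℂ → ℂ}
    (hG : ∀ w ∈ Metric.ball (0 : ℂ) 1, HasDerivAt G (Φ w) w)
    (hΦ : ContinuousOn Φ (Metric.ball 0 1)) {z : ℂ} (hz : ‖z‖ < 1) :
    ∫ s in (0 : ℝ)..1, z * Φ (z * s) = G z - G 0 := by
  have h := intervalIntegral.integral_eq_sub_of_hasDerivAt (a := 0) (b := 1)
    (f := fun s : ℝ => G (z * s)) (f' := fun s => z * Φ (z * s)) (fun s hs => by
      have h1 : HasDerivAt (fun s : ℝ => z * (s : ℂ)) z s := by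
        simpa using (Complex.ofRealCLM.hasDerivAt (x := s)).const_mul z
      have := (hG _ (mul_ofReal_mem_ball hz hs)).comp s h1
      rw [mul_comm]
      exact this)
    (ContinuousOn.intervalIntegrable ((hΦ.comp_segment hz).const_smul z))
  simpa using h

theorem uniformContinuousOn_ball_of_hasDerivAt {G Φ : ℂ → ℂ} {C : ℝ}
    (hG : ∀ w ∈ Metric.ball (0 : ℂ) 1, HasDerivAt G (Φ w) w)
    (hΦ : ∀ w ∈ Metric.ball (0 : ℂ) 1, ‖Φ w‖ ≤ C) : UniformContinuousOn G (Metric.ball 0 1) := by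
  have hC : 0 ≤ C := (norm_nonneg _).trans (hΦ 0 (by simp))
  refine LipschitzOnWith.uniformContinuousOn (K := ⟨C, hC⟩) ?_
  refine LipschitzOnWith.of_dist_le_mul fun x hx y hy => ?_
  rw [dist_eq_norm, dist_eq_norm]
  exact (convex_ball (0 : ℂ) 1).norm_image_sub_le_of_norm_hasDerivWithin_le
    (fun w hw => (hG w hw).hasDerivWithinAt) hΦ hy hx

theorem uniformContinuousOn_of_forall_approx {S : Set ℂ} {G : ℂ → ℂ}
    (h : ∀ ε > 0, ∃ P : ℂ → ℂ, UniformContinuousOn P S ∧ ∀ z ∈ S, ‖G z - P z‖ ≤ ε) :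
    UniformContinuousOn G S := by
  rw [Metric.uniformContinuousOn_iff]
  intro ε hε
  obtain ⟨P, hP, hGP⟩ := h (ε / 4) (by positivity)
  obtain ⟨δ, hδ, hPδ⟩ := Metric.uniformContinuousOn_iff.1 hP (ε / 4) (by positivity)
  refine ⟨δ, hδ, fun x hx y hy hxy => ?_⟩
  have h1 := hPδ x hx y hy hxy
  have h2 := hGP x hx
  have h3 := hGP y hy
  rw [← dist_eq_norm] at h2 h3
  have h4 := dist_triangle4 (G x) (P x) (P y) (G y)
  rw [dist_comm (P y)] at h4
  linarith

theorem sum_range_succ_sub_eq_taylorBlock (a : ℕ → ℂ) {M N : ℕ} (h : M ≤ N) (w : ℂ) :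
    ∑ k ∈ Finset.range (N + 1), a k * w ^ k =
      ∑ k ∈ Finset.range (M + 1), a k * w ^ k + w * taylorBlock a M N w := by
  rw [Finset.sum_range_succ' _ N, Finset.sum_range_succ' _ M,
    ← Finset.sum_range_add_sum_Ico _ h, taylorBlock, Finset.mul_sum]
  have : ∑ k ∈ Finset.Ico M N, a (k + 1) * w ^ (k + 1) =
      ∑ k ∈ Finset.Ico M N, w * (a (k + 1) * w ^ k) :=
    Finset.sum_congr rfl fun k _ => by ring
  rw [this]; ring

theorem exists_isMultiplier_uniformContinuousOn_primitive {F : ℂ → ℂ} (hF : MemA21 F) :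
    ∃ E G : ℂ → ℂ, IsMultiplier E ∧
      (∀ w ∈ Metric.ball (0 : ℂ) 1, HasDerivAt G (E w * F w) w) ∧
      UniformContinuousOn G (Metric.ball 0 1) := by
  obtain ⟨E, N, hE, hN, hEN⟩ :=
    exists_isMultiplier_norm_segmentIntegral_le (summable_taylorCoeff_of_memA21 hF)
  set a := taylorCoeff F
  have hFd : DifferentiableOn ℂ F (Metric.ball 0 1) := unitDisc_eq_ball ▸ hF.1
  have hEF : DifferentiableOn ℂ (fun w => E w * F w) (Metric.ball 0 1) := hE.1.mul hFd
  obtain ⟨G, hG⟩ := hEF.isExactOn_ball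
  refine ⟨E, G, hE, hG, uniformContinuousOn_of_forall_approx fun ε hε => ?_⟩
  obtain ⟨M, hM⟩ := exists_pow_lt_of_lt_one (half_pos hε) (by norm_num : (1 / 2 : ℝ) < 1)
  set p : ℕ → ℂ → ℂ := fun n w => ∑ k ∈ Finset.range (N n + 1), a k * w ^ k with hp
  have hpd : ∀ n, Differentiable ℂ (p n) := fun n => by simp only [hp]; fun_prop
  have hEp : ∀ n, DifferentiableOn ℂ (fun w => E w * p n w) (Metric.ball 0 1) := fun n =>
    hE.1.mul (hpd n).differentiableOn
  have hseg : ∀ {Φ : ℂ → ℂ}, DifferentiableOn ℂ Φ (Metric.ball 0 1) → ∀ {z : ℂ}, ‖z‖ < 1 →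
      IntervalIntegrable (fun s : ℝ => z * Φ (z * s)) volume 0 1 := fun hΦ z hz =>
    ContinuousOn.intervalIntegrable ((hΦ.continuousOn.comp_segment hz).const_smul z)
  obtain ⟨H, hH⟩ := (hEp M).isExactOn_ball
  obtain ⟨C, hC⟩ := (isCompact_closedBall (0 : ℂ) 1).exists_bound_of_continuousOn
    (hpd M).continuous.continuousOn
  refine ⟨fun z => H z + (G 0 - H 0), ?_, fun z hz => ?_⟩
  · refine uniformContinuousOn_ball_of_hasDerivAt (C := C) (fun w hw => (hH w hw).add_const _) ?_
    intro w hw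
    rw [norm_mul]
    have h1 := hC w (Metric.ball_subset_closedBall hw)
    have h2 := hE.2.2.1 w hw
    nlinarith [norm_nonneg (p M w), norm_nonneg (E w)]
  · have hz1 : ‖z‖ < 1 := mem_ball_zero_iff.1 hz
    set I : ℕ → ℂ := fun n => ∫ s in (0 : ℝ)..1, z * (E (z * s) * p n (z * s)) with hI
    have hstep : ∀ n, ‖I (n + 1) - I n‖ ≤ (1 / 2) ^ n := by
      intro n
      have e : I (n + 1) - I n =
          z * segmentIntegral z fun w => E w * taylorBlock a (N n) (N (n + 1)) w := by
        simp only [hI, segmentIntegral]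
        rw [← intervalIntegral.integral_sub (hseg (hEp (n + 1)) hz1) (hseg (hEp n) hz1),
          ← intervalIntegral.integral_const_mul]
        refine intervalIntegral.integral_congr fun s _ => ?_
        simp only [hp]
        rw [sum_range_succ_sub_eq_taylorBlock a (hN.monotone n.le_succ)]
        ring
      rw [e, norm_mul]
      have := hEN n z hz1
      nlinarith [norm_nonneg z, norm_nonneg
        (segmentIntegral z fun w => E w * taylorBlock a (N n) (N (n + 1)) w)]
    have hsum : ∀ m, ‖I (M + m) - I M‖ ≤ 2 * (1 / 2) ^ M - 2 * (1 / 2) ^ (M + m) := by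
      intro m
      induction m with
      | zero => simp
      | succ m ih =>
        have h1 := norm_add_le (I (M + m + 1) - I (M + m)) (I (M + m) - I M)
        rw [sub_add_sub_cancel] at h1
        have h2 := hstep (M + m)
        rw [← add_assoc, pow_succ _ (M + m)]
        linarith
    have hlim : Tendsto I atTop (𝓝 (G z - G 0)) := by
      rw [← sub_eq_integral_of_hasDerivAt hG hEF.continuousOn hz1]
      have hzs : ∀ s ∈ Set.uIoc (0 : ℝ) 1, ‖z * s‖ ≤ ‖z‖ := by
        intro s hs
        rw [Set.uIoc_of_le zero_le_one] at hs
        rw [norm_mul, Complex.norm_real, Real.norm_eq_abs, abs_of_nonneg hs.1.le]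
        exact mul_le_of_le_one_right (norm_nonneg _) hs.2
      have hser : HasSum (fun k : ℕ => ∫ s in (0 : ℝ)..1, z * (E (z * s) * (a k * (z * s) ^ k)))
          (∫ s in (0 : ℝ)..1, z * (E (z * s) * F (z * s))) := by
        refine intervalIntegral.hasSum_integral_of_dominated_convergence
          (fun k _ => ‖a k * z ^ k‖) ?_ ?_ ?_ ?_ ?_
        · intro k
          rw [Set.uIoc_of_le zero_le_one]
          exact (hseg (Φ := fun w => E w * (a k * w ^ k))
            (hE.1.mul (by fun_prop)) hz1).aestronglyMeasurable
        · refine fun k => ae_of_all _ fun s hs => ?_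
          have h1 := hE.2.2.1 _ (mul_ofReal_mem_ball hz1 (Set.uIoc_subset_uIcc hs))
          have h2 : ‖a k * (z * s) ^ k‖ ≤ ‖a k * z ^ k‖ := by
            rw [norm_mul, norm_mul, norm_pow, norm_pow]
            gcongr
            exact hzs s hs
          rw [norm_mul, norm_mul]
          calc _ ≤ 1 * (1 * ‖a k * z ^ k‖) := by gcongr
            _ = _ := by ring
        · exact ae_of_all _ fun s _ => (hasSum_taylorCoeff hFd hz1).summable.norm
        · exact intervalIntegrable_const
        · exact ae_of_all _ fun s hs =>
            ((hasSum_taylorCoeff hFd ((hzs s hs).trans_lt hz1)).mul_left _).mul_left _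
      have h := hser.tendsto_sum_nat.comp ((tendsto_add_atTop_nat 1).comp hN.tendsto_atTop)
      refine h.congr fun n => ?_
      simp only [Function.comp, hI]
      rw [← intervalIntegral.integral_finsetSum fun k _ =>
        hseg (Φ := fun w => E w * (a k * w ^ k)) (hE.1.mul (by fun_prop)) hz1]
      refine intervalIntegral.integral_congr fun s _ => ?_
      simp only [hp, Finset.mul_sum]
    have hlim' : Tendsto (fun m => ‖I (M + m) - I M‖) atTop (𝓝 ‖G z - G 0 - I M‖) := by
      refine Tendsto.norm (Tendsto.sub_const ?_ _)
      have := (tendsto_add_atTop_iff_nat M).2 hlim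
      simpa only [add_comm] using this
    have h1 : ‖G z - G 0 - I M‖ ≤ 2 * (1 / 2) ^ M :=
      le_of_tendsto hlim' (Eventually.of_forall fun m => (hsum m).trans (by
        have : (0 : ℝ) ≤ 2 * (1 / 2) ^ (M + m) := by positivity
        linarith))
    have h2 : I M = H z - H 0 := sub_eq_integral_of_hasDerivAt hH (hEp M).continuousOn hz1
    have h3 : G z - (H z + (G 0 - H 0)) = G z - G 0 - I M := by rw [h2]; ring
    rw [h3]
    linarith

theorem meanOsc_le_of_forall_norm_sub_le {g : ℝ → ℂ} (hg : Continuous g) {θ₀ t C : ℝ}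
    (ht : 0 < t)
    (h : ∀ θ ∈ Set.Ioo (θ₀ - Real.pi * t) (θ₀ + Real.pi * t),
      ∀ θ' ∈ Set.Ioo (θ₀ - Real.pi * t) (θ₀ + Real.pi * t), ‖g θ - g θ'‖ ≤ C) :
    meanOsc g θ₀ t ≤ C := by
  set I := Set.Ioo (θ₀ - Real.pi * t) (θ₀ + Real.pi * t) with hI
  have hpt : 0 < Real.pi * t := mul_pos Real.pi_pos ht
  have hvol : volume.real I = 2 * Real.pi * t := by
    rw [hI, Real.volume_real_Ioo_of_le (by linarith)]; ring
  have hIfin : volume I ≠ ⊤ := measure_Ioo_lt_top.ne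
  have hI0 : volume I ≠ 0 := fun h0 => by
    rw [Measure.real, h0] at hvol
    rw [ENNReal.toReal_zero] at hvol
    linarith
  have hgi : IntegrableOn g I :=
    (hg.continuousOn.integrableOn_Icc).mono_set Set.Ioo_subset_Icc_self
  have havg : arcAvg g θ₀ t = ⨍ θ in I, g θ := by
    rw [setAverage_eq, hvol, arcAvg]
  have hd : ∀ θ ∈ I, ‖g θ - arcAvg g θ₀ t‖ ≤ C := by
    intro θ hθ
    have := (convex_closedBall (g θ) C).set_average_mem Metric.isClosed_closedBall hI0 hIfin
      ((ae_restrict_iff' measurableSet_Ioo).2 (ae_of_all _ fun θ' hθ' =>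
        mem_closedBall_iff_norm.2 (h θ' hθ' θ hθ))) hgi
    rw [← havg, mem_closedBall_iff_norm'] at this
    exact this
  rw [meanOsc, inv_mul_le_iff₀ (by positivity)]
  have h1 := norm_setIntegral_le_of_norm_le_const (f := fun θ => ‖g θ - arcAvg g θ₀ t‖)
    hIfin.lt_top (C := C) (fun θ hθ => by rw [norm_norm]; exact hd θ hθ)
  rw [hvol] at h1
  linarith [le_of_abs_le h1]

theorem isVMO_of_uniformContinuous {g : ℝ → ℂ} (hg : UniformContinuous g) {M : ℝ}
    (hM : ∀ θ, ‖g θ‖ ≤ M) (hper : ∀ θ, g (θ + 2 * Real.pi) = g θ) : IsVMO g := by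
  refine ⟨⟨hper, (hg.continuous.continuousOn.integrableOn_Icc).mono_set
    Set.Ioc_subset_Icc_self, 2 * M, fun θ₀ t ht _ =>
      meanOsc_le_of_forall_norm_sub_le hg.continuous ht fun θ _ θ' _ => ?_⟩, fun ε hε => ?_⟩
  · linarith [norm_sub_le (g θ) (g θ'), hM θ, hM θ']
  · obtain ⟨δ, hδ, h⟩ := Metric.uniformContinuous_iff.1 hg ε hε
    have hpi := Real.pi_pos
    refine ⟨δ / (2 * Real.pi), by positivity, fun θ₀ t ht htδ =>
      meanOsc_le_of_forall_norm_sub_le hg.continuous ht fun θ hθ θ' hθ' => ?_⟩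
    rw [lt_div_iff₀ (by positivity)] at htδ
    rw [← dist_eq_norm]
    refine (h ?_).le
    rw [Real.dist_eq, abs_lt]
    constructor <;> nlinarith [hθ.1, hθ.2, hθ'.1, hθ'.2]

theorem norm_circlePt (θ : ℝ) : ‖circlePt θ‖ = 1 := Complex.norm_exp_ofReal_mul_I θ

theorem uniformContinuous_circlePt : UniformContinuous circlePt := by
  refine (lipschitzWith_of_nnnorm_deriv_le (C := 1) (𝕜 := ℝ) (f := circlePt) ?_ ?_).uniformContinuous
  · unfold circlePt
    fun_prop
  · intro θ
    have h : HasDerivAt circlePt (circlePt θ * (1 * Complex.I)) θ :=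
      ((Complex.ofRealCLM.hasDerivAt (x := θ)).mul_const Complex.I).cexp
    rw [h.deriv, ← NNReal.coe_le_coe]
    simp [norm_circlePt]

theorem exists_memQA_of_uniformContinuousOn {G : ℂ → ℂ}
    (hG : DifferentiableOn ℂ G (Metric.ball 0 1)) (hu : UniformContinuousOn G (Metric.ball 0 1)) :
    ∃ Gb, MemQA G Gb := by
  set B := Metric.ball (0 : ℂ) 1 with hB
  have hcl : closure B = Metric.closedBall 0 1 := closure_ball _ one_ne_zero
  have hlim : ∀ x ∈ closure B, ∃ y, Tendsto G (𝓝[B] x) (𝓝 y) := by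
    intro x hx
    have := mem_closure_iff_nhdsWithin_neBot.1 hx
    have hc : Cauchy (𝓝[B] x) := cauchy_nhds.mono nhdsWithin_le_nhds
    obtain ⟨y, hy⟩ := CompleteSpace.complete (hc.map_of_le hu (le_principal_iff.2 self_mem_nhdsWithin))
    exact ⟨y, hy⟩
  set g := extendFrom B G with hg
  have hgc : ContinuousOn g (Metric.closedBall 0 1) := by
    rw [← hcl]; exact continuousOn_extendFrom subset_rfl hlim
  have hgG : ∀ z ∈ B, g z = G z := extendFrom_extends hG.continuousOn
  obtain ⟨M, hM⟩ := (isCompact_closedBall (0 : ℂ) 1).exists_bound_of_continuousOn hgc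
  have hgu := (isCompact_closedBall (0 : ℂ) 1).uniformContinuousOn_of_continuous hgc
  have hcirc : ∀ θ, circlePt θ ∈ Metric.closedBall (0 : ℂ) 1 := fun θ => by simp [norm_circlePt]
  refine ⟨fun θ => g (circlePt θ), ⟨unitDisc_eq_ball ▸ hG, M, fun z hz => ?_⟩, ?_,
    isVMO_of_uniformContinuous (M := M) ?_ (fun θ => hM _ (hcirc θ)) fun θ => ?_⟩
  · rw [unitDisc_eq_ball] at hz
    rw [← hgG z hz]
    exact hM z (Metric.ball_subset_closedBall hz)
  · refine ae_of_all _ fun θ => ?_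
    have hr : ∀ r ∈ Set.Ioo (0 : ℝ) 1, (r : ℂ) * circlePt θ ∈ B := fun r hr => by
      rw [hB, mem_ball_zero_iff, norm_mul, norm_circlePt, Complex.norm_real,
        Real.norm_of_nonneg hr.1.le, mul_one]
      exact hr.2
    have h1 : Tendsto (fun r : ℝ => (r : ℂ) * circlePt θ) (𝓝[<] 1)
        (𝓝[Metric.closedBall 0 1] (circlePt θ)) := by
      refine tendsto_nhdsWithin_iff.2 ⟨?_, ?_⟩
      · have : Tendsto (fun r : ℝ => (r : ℂ) * circlePt θ) (𝓝[<] 1)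
            (𝓝 (((1 : ℝ) : ℂ) * circlePt θ)) :=
          Tendsto.mono_left (Continuous.tendsto (by fun_prop) 1) nhdsWithin_le_nhds
        simpa using this
      · filter_upwards [Ioo_mem_nhdsLT (zero_lt_one (α := ℝ))] with r h
        exact Metric.ball_subset_closedBall (hr r h)
    refine ((hgc _ (hcirc θ)).tendsto.comp h1).congr' ?_
    filter_upwards [Ioo_mem_nhdsLT (zero_lt_one (α := ℝ))] with r h
    exact hgG _ (hr r h)
  · rw [← uniformContinuousOn_univ]
    exact hgu.comp (uniformContinuousOn_univ.2 uniformContinuous_circlePt) fun θ _ => hcirc θ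
  · congr 1
    simp only [circlePt]
    push_cast
    rw [add_mul, Complex.exp_add, Complex.exp_two_pi_mul_I, mul_one]

theorem isOpen_unitDisc : IsOpen unitDisc := unitDisc_eq_ball ▸ Metric.isOpen_ball

theorem one_sub_norm_sq_nonneg {z : ℂ} (hz : z ∈ unitDisc) : 0 ≤ 1 - ‖z‖ ^ 2 := by
  have h : ‖z‖ < 1 := hz
  nlinarith [norm_nonneg z]

theorem MemA21.mul {φ F : ℂ → ℂ} (hF : MemA21 F) (hφ : DifferentiableOn ℂ φ unitDisc) {C : ℝ}
    (hC : ∀ z ∈ unitDisc, ‖φ z‖ ≤ C) : MemA21 fun z => φ z * F z := by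
  have hd := hφ.mul hF.1
  refine ⟨hd, (hF.2.const_mul (C ^ 2)).mono' ?_ ?_⟩
  · refine ContinuousOn.aestronglyMeasurable ?_ isOpen_unitDisc.measurableSet
    exact (hd.continuousOn.norm.pow 2).mul (by fun_prop)
  · refine (ae_restrict_iff' isOpen_unitDisc.measurableSet).2 (ae_of_all _ fun z hz => ?_)
    have h1 := one_sub_norm_sq_nonneg hz
    have h2 := hC z hz
    rw [Real.norm_of_nonneg (by positivity), norm_mul, mul_pow, mul_assoc]
    gcongr

theorem sq_norm_sub_mul_le {a b c : ℂ} {x : ℝ} (hx : 0 ≤ x) :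
    ‖a - c‖ ^ 2 * x ≤ 2 * (‖a - b‖ ^ 2 * x) + 2 * (‖b - c‖ ^ 2 * x) := by
  have h : ‖a - c‖ ≤ ‖a - b‖ + ‖b - c‖ := norm_sub_le_norm_sub_add_norm_sub a b c
  have h2 : ‖a - c‖ ^ 2 ≤ 2 * ‖a - b‖ ^ 2 + 2 * ‖b - c‖ ^ 2 := by
    nlinarith [sq_nonneg (‖a - b‖ - ‖b - c‖), norm_nonneg (a - c)]
  nlinarith

theorem MemA21.integrableOn_sub {F H : ℂ → ℂ} (hF : MemA21 F) (hH : MemA21 H) :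
    IntegrableOn (fun z => ‖F z - H z‖ ^ 2 * (1 - ‖z‖ ^ 2)) unitDisc := by
  refine ((hF.2.const_mul 2).add (hH.2.const_mul 2)).mono' ?_ ?_
  · refine ContinuousOn.aestronglyMeasurable ?_ isOpen_unitDisc.measurableSet
    exact ((hF.1.continuousOn.sub hH.1.continuousOn).norm.pow 2).mul (by fun_prop)
  · refine (ae_restrict_iff' isOpen_unitDisc.measurableSet).2 (ae_of_all _ fun z hz => ?_)
    have h1 := one_sub_norm_sq_nonneg hz
    rw [Real.norm_of_nonneg (by positivity)]
    simpa using sq_norm_sub_mul_le (a := F z) (b := 0) (c := H z) h1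

theorem a21distSq_le {F W H : ℂ → ℂ} (hF : MemA21 F) (hW : MemA21 W) (hH : MemA21 H) :
    a21distSq F H ≤ 2 * a21distSq F W + 2 * a21distSq W H := by
  simp only [a21distSq]
  rw [← integral_const_mul, ← integral_const_mul, ← integral_add
    ((hF.integrableOn_sub hW).const_mul 2) ((hW.integrableOn_sub hH).const_mul 2)]
  exact setIntegral_mono_on (hF.integrableOn_sub hH)
    (((hF.integrableOn_sub hW).const_mul 2).add ((hW.integrableOn_sub hH).const_mul 2))
    isOpen_unitDisc.measurableSet fun z hz => sq_norm_sub_mul_le (one_sub_norm_sq_nonneg hz)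

theorem tendsto_a21distSq_mul {F φ : ℂ → ℂ} {u : ℕ → ℂ → ℂ} (hF : MemA21 F)
    (hφ : ContinuousOn φ unitDisc) (hu : ∀ n, ContinuousOn (u n) unitDisc) {C : ℝ}
    (hC : ∀ n, ∀ z ∈ unitDisc, ‖u n z‖ ≤ C)
    (hlim : ∀ z ∈ unitDisc, Tendsto (fun n => u n z) atTop (𝓝 (φ z))) :
    Tendsto (fun n => a21distSq (fun z => φ z * F z) fun z => u n z * F z) atTop (𝓝 0) := by
  have hφC : ∀ z ∈ unitDisc, ‖φ z‖ ≤ C := fun z hz =>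
    le_of_tendsto (hlim z hz).norm (Eventually.of_forall fun n => hC n z hz)
  have h0 : (0 : ℝ) = ∫ z in unitDisc, (0 : ℝ) := by simp
  rw [h0]
  simp only [a21distSq]
  refine tendsto_integral_of_dominated_convergence
    (fun z => (2 * C) ^ 2 * (‖F z‖ ^ 2 * (1 - ‖z‖ ^ 2))) (fun n => ?_)
    (hF.2.const_mul _) (fun n => ?_) ?_
  · refine ContinuousOn.aestronglyMeasurable ?_ isOpen_unitDisc.measurableSet
    exact (((hφ.mul hF.1.continuousOn).sub ((hu n).mul hF.1.continuousOn)).norm.pow 2).mul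
      (by fun_prop)
  · refine (ae_restrict_iff' isOpen_unitDisc.measurableSet).2 (ae_of_all _ fun z hz => ?_)
    have h1 := one_sub_norm_sq_nonneg hz
    have h2 : ‖φ z - u n z‖ ≤ 2 * C := by
      linarith [norm_sub_le (φ z) (u n z), hφC z hz, hC n z hz]
    rw [Real.norm_of_nonneg (by positivity), ← sub_mul, norm_mul, mul_pow, mul_assoc]
    gcongr
  · refine (ae_restrict_iff' isOpen_unitDisc.measurableSet).2 (ae_of_all _ fun z hz => ?_)
    have h := ((((tendsto_const_nhds (x := φ z)).sub (hlim z hz)).mul_const (F z)).norm.pow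
      2).mul_const (1 - ‖z‖ ^ 2)
    simpa [sub_mul] using h

theorem exists_polynomial_norm_sub_le {φ : ℂ → ℂ} {R ε : ℝ} (hR : 1 < R)
    (hφ : DifferentiableOn ℂ φ (Metric.ball 0 R)) (hε : 0 < ε) :
    ∃ P : Polynomial ℂ, ∀ z ∈ unitDisc, ‖φ z - P.eval z‖ ≤ ε := by
  have hs := summable_norm_taylorCoeff hφ hR
  obtain ⟨n, hn⟩ := ((tendsto_sum_nat_add fun k => ‖taylorCoeff φ k‖).eventually_le_const
    hε).exists
  refine ⟨∑ k ∈ Finset.range n, Polynomial.monomial k (taylorCoeff φ k), fun z hz => ?_⟩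
  have hz1 : ‖z‖ < 1 := hz
  have hT := hasSum_taylorCoeff hφ (hz1.trans hR)
  have hP : (∑ k ∈ Finset.range n, Polynomial.monomial k (taylorCoeff φ k)).eval z =
      ∑ k ∈ Finset.range n, taylorCoeff φ k * z ^ k := by
    simp [Polynomial.eval_finsetSum]
  have hb : ∀ k, ‖taylorCoeff φ (k + n) * z ^ (k + n)‖ ≤ ‖taylorCoeff φ (k + n)‖ := fun k => by
    rw [norm_mul, norm_pow]
    exact mul_le_of_le_one_right (norm_nonneg _) (pow_le_one₀ (norm_nonneg _) hz1.le)
  rw [hP, ← hT.tsum_eq, ← hT.summable.sum_add_tsum_nat_add n, add_sub_cancel_left]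
  exact (tsum_of_norm_bounded ((summable_nat_add_iff n).2 hs).hasSum hb).trans hn

theorem exists_polynomial_a21distSq_le {F φ : ℂ → ℂ} (hF : MemA21 F)
    (hφ : DifferentiableOn ℂ φ unitDisc) {C : ℝ} (hC : ∀ z ∈ unitDisc, ‖φ z‖ ≤ C)
    {ε : ℝ} (hε : 0 < ε) :
    ∃ P : Polynomial ℂ, a21distSq (fun z => φ z * F z) (fun z => P.eval z * F z) ≤ ε := by
  set ρ : ℕ → ℝ := fun n => 1 - 1 / ((n : ℝ) + 2) with hρ
  have hρ1 : ∀ n, ρ n < 1 := fun n => by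
    have : 0 < 1 / ((n : ℝ) + 2) := by positivity
    simp only [hρ]; linarith
  have hρ0 : ∀ n, 0 < ρ n := fun n => by
    have : 1 / ((n : ℝ) + 2) < 1 := by
      rw [div_lt_one (by positivity)]; linarith [(n.cast_nonneg : (0 : ℝ) ≤ n)]
    simp only [hρ]; linarith
  have hlimρ : Tendsto ρ atTop (𝓝 1) := by
    have h : Tendsto (fun n : ℕ => 1 / ((n : ℝ) + 2)) atTop (𝓝 0) :=
      tendsto_const_nhds.div_atTop (tendsto_natCast_atTop_atTop.atTop_add tendsto_const_nhds)
    simpa [hρ] using h.const_sub 1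
  have hmaps : ∀ n, Set.MapsTo (fun z : ℂ => (ρ n : ℂ) * z) (Metric.ball 0 (1 / ρ n)) unitDisc := by
    intro n z hz
    rw [mem_ball_zero_iff, lt_div_iff₀ (hρ0 n)] at hz
    rw [unitDisc_eq_ball, mem_ball_zero_iff, norm_mul, Complex.norm_real,
      Real.norm_of_nonneg (hρ0 n).le, mul_comm]
    exact hz
  have hR : ∀ n, 1 < 1 / ρ n := fun n => by
    rw [lt_div_iff₀ (hρ0 n), one_mul]; exact hρ1 n
  choose P hP using fun n => exists_polynomial_norm_sub_le (hR n)
    (hφ.comp ((differentiable_id.const_mul (ρ n : ℂ)).differentiableOn) (hmaps n))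
    (Nat.one_div_pos_of_nat (α := ℝ) (n := n))
  have hsub : ∀ n, ∀ z ∈ unitDisc, (ρ n : ℂ) * z ∈ unitDisc := fun n z hz =>
    hmaps n (Metric.ball_subset_ball (hR n).le (unitDisc_eq_ball ▸ hz))
  have key := tendsto_a21distSq_mul (u := fun n z => (P n).eval z) (C := C + 1) hF
    hφ.continuousOn (fun n => (P n).continuous.continuousOn) (fun n z hz => ?_) (fun z hz => ?_)
  · obtain ⟨n, hn⟩ := (key.eventually_le_const hε).exists
    exact ⟨P n, hn⟩
  · have h1 := hP n z hz
    have h2 := hC _ (hsub n z hz)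
    have h3 : 1 / ((n : ℝ) + 1) ≤ 1 := by
      rw [div_le_one (by positivity)]; linarith [(n.cast_nonneg : (0 : ℝ) ≤ n)]
    have h4 := norm_sub_norm_le ((P n).eval z) (φ (ρ n * z))
    rw [norm_sub_rev] at h4
    simp only [Function.comp_apply] at h1
    linarith
  · have h1 : Tendsto (fun n => φ (ρ n * z)) atTop (𝓝 (φ z)) := by
      have hc := (hφ.continuousOn z hz).continuousAt (isOpen_unitDisc.mem_nhds hz)
      refine hc.tendsto.comp ?_
      have := ((Complex.continuous_ofReal.tendsto 1).comp hlimρ).mul_const z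
      simpa using this
    have h2 : Tendsto (fun n => φ (ρ n * z) - (P n).eval z) atTop (𝓝 0) :=
      squeeze_zero_norm (fun n => hP n z hz) tendsto_one_div_add_atTop_nhds_zero_nat
    simpa using h1.sub h2

theorem IsMultiplier.re_pos {E : ℂ → ℂ} (hE : IsMultiplier E) {z : ℂ}
    (hz : z ∈ Metric.ball (0 : ℂ) 1) : 0 < (E z).re := by
  refine (hE.2.1 z hz).lt_of_ne fun h0 => ?_
  have hmax : IsMaxOn (norm ∘ fun w => Complex.exp (-E w)) (Metric.ball 0 1) z := by
    intro w hw
    rw [Set.mem_ofPred_eq, Function.comp_apply, Function.comp_apply, Complex.norm_exp,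
      Complex.norm_exp, Real.exp_le_exp, Complex.neg_re, Complex.neg_re, ← h0]
    linarith [hE.2.1 w hw]
  have h := Complex.norm_eqOn_of_isPreconnected_of_isMaxOn
    (convex_ball (0 : ℂ) 1).isPreconnected Metric.isOpen_ball hE.1.neg.cexp hz hmax
    (Metric.mem_ball_self one_pos)
  simp only [Function.comp_apply, Function.const_apply, Complex.norm_exp, Real.exp_eq_exp,
    Pi.neg_apply, Complex.neg_re] at h
  linarith [hE.2.2.2]

theorem exists_forall_norm_eval_le (P : Polynomial ℂ) :
    ∃ C, ∀ z ∈ unitDisc, ‖P.eval z‖ ≤ C := by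
  obtain ⟨C, hC⟩ := (isCompact_closedBall (0 : ℂ) 1).exists_bound_of_continuousOn
    P.continuous.continuousOn
  exact ⟨C, fun z hz => hC z (Metric.ball_subset_closedBall (unitDisc_eq_ball ▸ hz))⟩

/-- Multiplication by a bounded function with positive real part preserves the closure of the
polynomial multiples. -/
theorem IsMultiplier.a21closure_mul {E F : ℂ → ℂ} (hE : IsMultiplier E) (hF : MemA21 F) :
    A21closure (fun z => E z * F z) = A21closure F := by
  obtain ⟨hEd, hE0, hE1, -⟩ := id hE
  rw [← unitDisc_eq_ball] at hEd hE0 hE1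
  have hEF : MemA21 fun z => E z * F z := hF.mul hEd hE1
  have hmul : ∀ {H : ℂ → ℂ}, MemA21 H → ∀ P : Polynomial ℂ, MemA21 fun z => P.eval z * H z :=
    fun hH P => hH.mul P.differentiable.differentiableOn (exists_forall_norm_eval_le P).choose_spec
  ext W
  refine and_congr_right fun hW => ⟨fun h ε hε => ?_, fun h ε hε => ?_⟩
  · obtain ⟨P, hP⟩ := h (ε / 4) (by positivity)
    obtain ⟨C, hC⟩ := exists_forall_norm_eval_le P
    obtain ⟨Q, hQ⟩ := exists_polynomial_a21distSq_le hF
      (P.differentiable.differentiableOn.mul hEd) (C := C * 1) (fun z hz => by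
        rw [Pi.mul_apply, norm_mul]
        exact mul_le_mul (hC z hz) (hE1 z hz) (norm_nonneg _) ((norm_nonneg _).trans (hC z hz)))
      (by positivity : 0 < ε / 4)
    refine ⟨Q, (a21distSq_le hW (hmul hEF P) (hmul hF Q)).trans ?_⟩
    simp only [Pi.mul_apply, mul_assoc] at hQ
    linarith
  · obtain ⟨P, hP⟩ := h (ε / 16) (by positivity)
    obtain ⟨C, hC⟩ := exists_forall_norm_eval_le P
    have hη : ∀ n : ℕ, 0 < 1 / ((n : ℝ) + 1) := fun n => by positivity
    have hre : ∀ n : ℕ, ∀ z ∈ unitDisc,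
        1 / ((n : ℝ) + 1) ≤ (E z + ((1 / ((n : ℝ) + 1) : ℝ) : ℂ)).re := fun n z hz => by
      rw [Complex.add_re, Complex.ofReal_re]
      linarith [hE0 z hz]
    have hnorm : ∀ n : ℕ, ∀ z ∈ unitDisc,
        1 / ((n : ℝ) + 1) ≤ ‖E z + ((1 / ((n : ℝ) + 1) : ℝ) : ℂ)‖ := fun n z hz =>
      (hre n z hz).trans (Complex.re_le_norm _)
    have hne : ∀ n : ℕ, ∀ z ∈ unitDisc, E z + ((1 / ((n : ℝ) + 1) : ℝ) : ℂ) ≠ 0 :=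
      fun n z hz => norm_pos_iff.1 ((hη n).trans_le (hnorm n z hz))
    set u : ℕ → ℂ → ℂ := fun n z => P.eval z / (E z + ((1 / ((n : ℝ) + 1) : ℝ) : ℂ)) with hu
    have hud : ∀ n, DifferentiableOn ℂ (u n) unitDisc := fun n =>
      P.differentiable.differentiableOn.div (hEd.add_const _) (hne n)
    have huC : ∀ n, ∀ z ∈ unitDisc, ‖u n z‖ ≤ C / (1 / ((n : ℝ) + 1)) := fun n z hz => by
      rw [hu, norm_div]
      exact div_le_div₀ ((norm_nonneg _).trans (hC z hz)) (hC z hz) (hη n) (hnorm n z hz)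
    have key := tendsto_a21distSq_mul (u := fun n z => u n z * E z) (C := C) hF
      P.continuous.continuousOn (fun n => ((hud n).mul hEd).continuousOn) (fun n z hz => ?_)
      (fun z hz => ?_)
    · obtain ⟨n, hn⟩ := (key.eventually_le_const (by positivity : 0 < ε / 16)).exists
      obtain ⟨Q, hQ⟩ := exists_polynomial_a21distSq_le hEF (hud n) (huC n)
        (by positivity : 0 < ε / 4)
      refine ⟨Q, (a21distSq_le hW (hEF.mul (hud n) (huC n)) (hmul hEF Q)).trans ?_⟩
      have h1 := a21distSq_le hW (hmul hF P) (hEF.mul (hud n) (huC n))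
      simp only [mul_assoc] at hn
      linarith
    · rw [hu, norm_mul, norm_div, div_mul_eq_mul_div, div_le_iff₀ ((hη n).trans_le (hnorm n z hz))]
      refine mul_le_mul (hC z hz) ?_ (norm_nonneg _) ((norm_nonneg _).trans (hC z hz))
      refine (sq_le_sq₀ (norm_nonneg _) (norm_nonneg _)).1 ?_
      rw [← Complex.normSq_eq_norm_sq, ← Complex.normSq_eq_norm_sq, Complex.normSq_apply,
        Complex.normSq_apply, Complex.add_re, Complex.add_im, Complex.ofReal_re, Complex.ofReal_im]
      nlinarith [hη n, hE0 z hz]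
    · have hEz : E z ≠ 0 := fun h0 => by
        have := hE.re_pos (unitDisc_eq_ball ▸ hz)
        simp [h0] at this
      have hlim : Tendsto (fun n : ℕ => ((1 / ((n : ℝ) + 1) : ℝ) : ℂ)) atTop (𝓝 0) := by
        rw [← Complex.ofReal_zero]
        exact (Complex.continuous_ofReal.tendsto 0).comp
          (tendsto_one_div_add_atTop_nhds_zero_nat (𝕜 := ℝ))
      have h2 := ((tendsto_const_nhds (x := P.eval z)).div
        ((tendsto_const_nhds (x := E z)).add hlim) (by simpa using hEz)).mul_const (E z)
      rw [add_zero, div_mul_cancel₀ _ hEz] at h2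
      exact h2

theorem MemA21.congr {F H : ℂ → ℂ} (hF : MemA21 F) (h : Set.EqOn H F unitDisc) : MemA21 H :=
  ⟨hF.1.congr h, hF.2.congr_fun (fun z hz => by rw [h hz]) isOpen_unitDisc.measurableSet⟩

theorem a21closure_congr {F H : ℂ → ℂ} (h : Set.EqOn F H unitDisc) :
    A21closure F = A21closure H := by
  ext W
  refine and_congr_right fun _ => forall₂_congr fun ε _ => exists_congr fun P => ?_
  rw [a21distSq, a21distSq, setIntegral_congr_fun isOpen_unitDisc.measurableSet fun z hz => by
    rw [h hz]]

end

/-- Corollary 4.3: for every `F ∈ A²₁` there is `G ∈ QA` with `G' ∈ A²₁` and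
`[G'] = [F]`. -/
theorem stmt_14 (F : ℂ → ℂ) (hF : MemA21 F) :
    ∃ (G : ℂ → ℂ) (Gb : ℝ → ℂ), MemQA G Gb ∧ MemA21 (deriv G) ∧
      A21closure (deriv G) = A21closure F := by
  obtain ⟨E, G, hE, hG, hu⟩ := exists_isMultiplier_uniformContinuousOn_primitive hF
  obtain ⟨Gb, hGb⟩ := exists_memQA_of_uniformContinuousOn
    (fun w hw => (hG w hw).differentiableAt.differentiableWithinAt) hu
  have hd : Set.EqOn (deriv G) (fun z => E z * F z) unitDisc := fun z hz =>
    (hG z (unitDisc_eq_ball ▸ hz)).deriv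
  have hEF : MemA21 fun z => E z * F z :=
    hF.mul (unitDisc_eq_ball ▸ hE.1) (unitDisc_eq_ball ▸ hE.2.2.1)
  exact ⟨G, Gb, hGb, hEF.congr hd, (a21closure_congr hd).trans (hE.a21closure_mul hF)⟩
end
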